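/- Let T be a near-triangulation with boundary cycle C = (u_1, ..., u_h, u_1) that contains at least one interior vertex and has no diagonals. Then for every boundary vertex u_i, the graph T − {u_i} is a near-triangulation. -/

import Mathlib

/-!
Common definitions.

A *plane graph* is a finite graph whose vertices are points of the plane `ℝ × ℝ` and whose
edges are drawn as straight-line segments between their endpoints (by Fáry's theorem every
planar graph admits such a drawing).  A *near-triangulation* is a plane graph that is properly
embedded, biconnected, and all of whose bounded faces are triangles (the faces are the
connected components of the complement of the drawing).  The boundary cycle lists, cyclically,
the vertices on the outer (unbounded) face.
-/

open scoped Classical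

noncomputable section

/-- A finite graph drawn in the plane: the vertices are points of `ℝ × ℝ` and each edge is
drawn as the straight-line segment between its endpoints. -/
structure PlaneGraph where
  verts : Finset (ℝ × ℝ)
  Adj : ℝ × ℝ → ℝ × ℝ → Prop
  symm : ∀ p q, Adj p q → Adj q p
  loopless : ∀ p, ¬ Adj p p
  mem_of_adj : ∀ p q, Adj p q → p ∈ verts ∧ q ∈ verts

namespace PlaneGraph

variable (G : PlaneGraph)

/-- The union of the (closed) segments realizing the edges of the graph. -/
def drawing : Set (ℝ × ℝ) := {x | ∃ p q, G.Adj p q ∧ x ∈ segment ℝ p q}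

/-- The straight-line drawing is a proper plane embedding: two edges meet only in common
endpoints and no vertex lies on an edge of which it is not an endpoint. -/
def IsEmbedded : Prop :=
  (∀ p q r s, G.Adj p q → G.Adj r s → ∀ x, x ∈ segment ℝ p q → x ∈ segment ℝ r s →
      ({p, q} : Set (ℝ × ℝ)) = {r, s} ∨
        (x ∈ ({p, q} : Set (ℝ × ℝ)) ∧ x ∈ ({r, s} : Set (ℝ × ℝ)))) ∧
  (∀ p q v, G.Adj p q → v ∈ G.verts → v ∈ segment ℝ p q → v = p ∨ v = q)

/-- Reachability by walks in the graph. -/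
def Reachable (p q : ℝ × ℝ) : Prop := Relation.ReflTransGen G.Adj p q

/-- The graph is connected. -/
def Connected : Prop := G.verts.Nonempty ∧ ∀ p ∈ G.verts, ∀ q ∈ G.verts, G.Reachable p q

/-- Deletion of a set of vertices together with all incident edges. -/
def deleteVerts (S : Finset (ℝ × ℝ)) : PlaneGraph where
  verts := G.verts \ S
  Adj := fun p q => G.Adj p q ∧ p ∉ S ∧ q ∉ S
  symm := fun p q h => ⟨G.symm p q h.1, h.2.2, h.2.1⟩
  loopless := fun p h => G.loopless p h.1
  mem_of_adj := fun p q h => by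
    obtain ⟨h1, h2⟩ := G.mem_of_adj p q h.1
    exact ⟨Finset.mem_sdiff.mpr ⟨h1, h.2.1⟩, Finset.mem_sdiff.mpr ⟨h2, h.2.2⟩⟩

/-- Deletion of a single edge (keeping all vertices). -/
def deleteEdge (p q : ℝ × ℝ) : PlaneGraph where
  verts := G.verts
  Adj := fun a b => G.Adj a b ∧ ¬ ((a = p ∧ b = q) ∨ (a = q ∧ b = p))
  symm := fun a b h => ⟨G.symm a b h.1, by tauto⟩
  loopless := fun a h => G.loopless a h.1
  mem_of_adj := fun a b h => G.mem_of_adj a b h.1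

/-- The (abstract, simple) graph obtained by contracting the edge `(p, q)`:
the vertex `q` is merged into `p`, which becomes the new contracted vertex. -/
def contractEdge (p q : ℝ × ℝ) : PlaneGraph where
  verts := G.verts.erase q
  Adj := fun a b =>
    a ≠ b ∧ a ∈ G.verts.erase q ∧ b ∈ G.verts.erase q ∧
      (G.Adj a b ∨ (a = p ∧ G.Adj q b) ∨ (b = p ∧ G.Adj q a))
  symm := fun a b h => by
    obtain ⟨h1, h2, h3, h4⟩ := h
    refine ⟨h1.symm, h3, h2, ?_⟩
    rcases h4 with h4 | h4 | h4
    · exact Or.inl (G.symm _ _ h4)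
    · exact Or.inr (Or.inr h4)
    · exact Or.inr (Or.inl h4)
  loopless := fun a h => h.1 rfl
  mem_of_adj := fun a b h => ⟨h.2.1, h.2.2.1⟩

/-- Biconnectivity: at least three vertices, connected, and deleting any single vertex leaves
a connected graph. -/
def Biconnected : Prop :=
  3 ≤ G.verts.card ∧ G.Connected ∧ ∀ v ∈ G.verts, (G.deleteVerts {v}).Connected

/-- A face of the plane graph: a connected component of the complement of the drawing. -/
def IsFace (F : Set (ℝ × ℝ)) : Prop :=
  ∃ x, x ∉ G.drawing ∧ F = connectedComponentIn G.drawingᶜ x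

/-- The open triangle with the three given corners. -/
def openTriangle (a b c : ℝ × ℝ) : Set (ℝ × ℝ) :=
  interior (convexHull ℝ ({a, b, c} : Set (ℝ × ℝ)))

/-- Every bounded (inner) face of the drawing is a triangular face of the graph. -/
def InnerFacesTriangles : Prop :=
  ∀ F, G.IsFace F → Bornology.IsBounded F →
    ∃ a ∈ G.verts, ∃ b ∈ G.verts, ∃ c ∈ G.verts,
      G.Adj a b ∧ G.Adj b c ∧ G.Adj a c ∧ F = openTriangle a b c

/-- A near-triangulation: a properly embedded biconnected plane graph all of whose faces are
triangles, except possibly the outer (unbounded) face. -/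
def IsNearTriangulation : Prop :=
  G.IsEmbedded ∧ G.Biconnected ∧ G.InnerFacesTriangles

/-- The outer region: the union of the unbounded components of the complement of the
drawing (for a near-triangulation this is the outer face). -/
def outerRegion : Set (ℝ × ℝ) :=
  {x | x ∉ G.drawing ∧ ¬ Bornology.IsBounded (connectedComponentIn G.drawingᶜ x)}

/-- `u : ZMod h → ℝ × ℝ` is the boundary cycle of `G`: an injective cyclic sequence
`u 0, u 1, …, u (h-1)` of vertices, consecutive ones adjacent, whose edges bound the outer
face and which contains every vertex lying on the boundary of the outer face. -/
def IsBoundaryCycle {h : ℕ} (u : ZMod h → ℝ × ℝ) : Prop :=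
  3 ≤ h ∧ Function.Injective u ∧
  (∀ i, u i ∈ G.verts) ∧
  (∀ i, G.Adj (u i) (u (i + 1))) ∧
  (∀ i, segment ℝ (u i) (u (i + 1)) ⊆ frontier G.outerRegion) ∧
  (∀ v ∈ G.verts, (v : ℝ × ℝ) ∈ frontier G.outerRegion → v ∈ Set.range u)

/-- An interior vertex: a vertex not on the boundary cycle. -/
def IsInteriorVtx {h : ℕ} (u : ZMod h → ℝ × ℝ) (v : ℝ × ℝ) : Prop :=
  v ∈ G.verts ∧ v ∉ Set.range u

/-- The edge `(p, q)` is a diagonal: it joins two non-consecutive boundary vertices. -/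
def IsDiagonalEdge {h : ℕ} (u : ZMod h → ℝ × ℝ) (p q : ℝ × ℝ) : Prop :=
  G.Adj p q ∧ ∃ i j : ZMod h, p = u i ∧ q = u j ∧ j ≠ i + 1 ∧ i ≠ j + 1

/-- The graph has no diagonals: any edge between boundary vertices joins consecutive ones. -/
def HasNoDiagonals {h : ℕ} (u : ZMod h → ℝ × ℝ) : Prop :=
  ∀ i j : ZMod h, G.Adj (u i) (u j) → j = i + 1 ∨ i = j + 1

/-- The degree of a vertex. -/
def degree (v : ℝ × ℝ) : ℕ := (G.verts.filter (fun w => G.Adj v w)).card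

/-- The degree of a vertex in the subgraph induced on the set `S` of vertices. -/
def degreeOn (S : Set (ℝ × ℝ)) (v : ℝ × ℝ) : ℕ :=
  (G.verts.filter (fun w => G.Adj v w ∧ w ∈ S)).card

/-- A total dominating set: every vertex of the graph is adjacent to a member of `D`. -/
def IsTDS (D : Finset (ℝ × ℝ)) : Prop :=
  D ⊆ G.verts ∧ ∀ v ∈ G.verts, ∃ d ∈ D, G.Adj v d

/-- The total domination number `γₜ`. -/
def totalDominationNumber : ℕ :=
  sInf {k | ∃ D : Finset (ℝ × ℝ), G.IsTDS D ∧ D.card = k}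

/-- Isomorphism of plane graphs as abstract graphs. -/
def IsIsoTo (H : PlaneGraph) : Prop :=
  ∃ f : ℝ × ℝ → ℝ × ℝ,
    Set.BijOn f (↑G.verts) (↑H.verts) ∧
    ∀ p ∈ G.verts, ∀ q ∈ G.verts, (G.Adj p q ↔ H.Adj (f p) (f q))

/-- The edge `(p, q)` is contractible: the contracted graph `G/e` is (abstractly isomorphic
to) a near-triangulation. -/
def IsContractible (p q : ℝ × ℝ) : Prop :=
  G.Adj p q ∧ ∃ H : PlaneGraph, H.IsNearTriangulation ∧ (G.contractEdge p q).IsIsoTo H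

/-- A separating triangle: a triangle of the graph with some vertex strictly inside it and
some vertex outside it. -/
def IsSeparatingTriangle (a b c : ℝ × ℝ) : Prop :=
  a ∈ G.verts ∧ b ∈ G.verts ∧ c ∈ G.verts ∧
  G.Adj a b ∧ G.Adj b c ∧ G.Adj a c ∧
  (∃ v ∈ G.verts, v ∈ openTriangle a b c) ∧
  (∃ v ∈ G.verts, v ∉ convexHull ℝ ({a, b, c} : Set (ℝ × ℝ)))

/-- Edge list of the first exceptional 12-vertex maximal outerplanar graph `H₁`
(boundary 12-cycle, central triangle `{0,4,8}`, ear triangles `{1,2,3}`, `{5,6,7}`,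
`{9,10,11}`, and the three remaining quadrilateral diagonals, all with the same
orientation). -/
def exc1Edges : List (Fin 12 × Fin 12) :=
  [(0,1),(1,2),(2,3),(3,4),(4,5),(5,6),(6,7),(7,8),(8,9),(9,10),(10,11),(11,0),
   (0,4),(4,8),(0,8),(1,3),(5,7),(9,11),(0,3),(4,7),(8,11)]

/-- Edge list of the second exceptional 12-vertex maximal outerplanar graph `H₂`
(same as `H₁` except that one quadrilateral diagonal has the opposite orientation). -/
def exc2Edges : List (Fin 12 × Fin 12) :=
  [(0,1),(1,2),(2,3),(3,4),(4,5),(5,6),(6,7),(7,8),(8,9),(9,10),(10,11),(11,0),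
   (0,4),(4,8),(0,8),(1,3),(5,7),(9,11),(0,3),(4,7),(0,9)]

/-- The exceptional graph `H₁`. -/
def H1graph : SimpleGraph (Fin 12) := SimpleGraph.fromRel (fun a b => (a, b) ∈ exc1Edges)

/-- The exceptional graph `H₂`. -/
def H2graph : SimpleGraph (Fin 12) := SimpleGraph.fromRel (fun a b => (a, b) ∈ exc2Edges)

/-- Isomorphism between a plane graph and a simple graph on `Fin 12`. -/
def IsIsoToSG (H : SimpleGraph (Fin 12)) : Prop :=
  ∃ f : ℝ × ℝ → Fin 12,
    Set.BijOn f (↑G.verts) Set.univ ∧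
    ∀ p ∈ G.verts, ∀ q ∈ G.verts, (G.Adj p q ↔ H.Adj (f p) (f q))

/-- `G` is isomorphic to `H₁` or to `H₂`. -/
def IsExceptional : Prop := G.IsIsoToSG H1graph ∨ G.IsIsoToSG H2graph

/-- A maximal outerplanar graph (MOP): a near-triangulation all of whose vertices lie on the
boundary cycle. -/
def IsMOP : Prop :=
  G.IsNearTriangulation ∧
    ∃ (h : ℕ) (u : ZMod h → ℝ × ℝ), G.IsBoundaryCycle u ∧ ∀ v ∈ G.verts, v ∈ Set.range u

/-- The graph is Hamiltonian: it has a cycle through all of its vertices. -/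
def IsHamiltonian : Prop :=
  ∃ (m : ℕ) (c : ZMod m → ℝ × ℝ), 3 ≤ m ∧ Function.Injective c ∧
    (∀ i, G.Adj (c i) (c (i + 1))) ∧ ∀ v ∈ G.verts, v ∈ Set.range c

/-- An outerplane graph: a properly embedded plane graph all of whose vertices lie on the
boundary of the outer region. -/
def IsOuterplane : Prop :=
  G.IsEmbedded ∧ ∀ v ∈ G.verts, (v : ℝ × ℝ) ∈ closure G.outerRegion

/-- The union of the boundary-cycle segments. -/
def boundaryDrawing {h : ℕ} (u : ZMod h → ℝ × ℝ) : Set (ℝ × ℝ) :=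
  ⋃ i : ZMod h, segment ℝ (u i) (u (i + 1))

/-- The open interior of the boundary cycle, viewed as a simple closed polygon. -/
def polygonInterior {h : ℕ} (u : ZMod h → ℝ × ℝ) : Set (ℝ × ℝ) :=
  {x | x ∉ boundaryDrawing u ∧
    Bornology.IsBounded (connectedComponentIn (boundaryDrawing u)ᶜ x)}

/-- The union of the segments realizing the diagonals of `G[C]`. -/
def diagonalDrawing {h : ℕ} (u : ZMod h → ℝ × ℝ) : Set (ℝ × ℝ) :=
  {x | ∃ i j : ZMod h, G.Adj (u i) (u j) ∧ j ≠ i + 1 ∧ i ≠ j + 1 ∧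
    x ∈ segment ℝ (u i) (u j)}

/-- A region of the subdivision of the interior of the boundary cycle by the diagonals of
`G[C]`: a connected component of the interior of the cycle minus the diagonals. -/
def IsSubdivisionRegion {h : ℕ} (u : ZMod h → ℝ × ℝ) (R : Set (ℝ × ℝ)) : Prop :=
  ∃ x ∈ polygonInterior u \ G.diagonalDrawing u,
    R = connectedComponentIn (polygonInterior u \ G.diagonalDrawing u) x

/-- The diagonal `(u i, u j)` is a side of the region `R`. -/
def IsSideOf {h : ℕ} (u : ZMod h → ℝ × ℝ) (R : Set (ℝ × ℝ)) (i j : ZMod h) : Prop :=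
  G.Adj (u i) (u j) ∧ j ≠ i + 1 ∧ i ≠ j + 1 ∧
    segment ℝ (u i) (u j) \ {u i, u j} ⊆ frontier R

/-- `v` lies on the opposite side of the diagonal `(u i, u j)` from the region `R`:
inside the boundary polygon, `v` cannot be joined to `R` without crossing the diagonal. -/
def OppositeSideOf {h : ℕ} (u : ZMod h → ℝ × ℝ) (R : Set (ℝ × ℝ)) (i j : ZMod h)
    (v : ℝ × ℝ) : Prop :=
  ∀ x ∈ R, v ∉ connectedComponentIn (polygonInterior u \ segment ℝ (u i) (u j)) x

/-- A terminal polygon: a region of the subdivision containing some interior vertex such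
that at most one of its sides has interior vertices of `G` on its opposite side
(i.e. at most one of the outer parts `T_out(P,d)` contains interior vertices). -/
def IsTerminalPolygon {h : ℕ} (u : ZMod h → ℝ × ℝ) (R : Set (ℝ × ℝ)) : Prop :=
  G.IsSubdivisionRegion u R ∧
  (∃ v, G.IsInteriorVtx u v ∧ v ∈ R) ∧
  ∀ i j k l : ZMod h,
    G.IsSideOf u R i j → G.IsSideOf u R k l →
    (∃ w, G.IsInteriorVtx u w ∧ OppositeSideOf u R i j w) →
    (∃ w, G.IsInteriorVtx u w ∧ OppositeSideOf u R k l w) →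
    ({u i, u j} : Set (ℝ × ℝ)) = {u k, u l}

/-- An irreducible near-triangulation: it has interior vertices, and for every boundary edge
`(u i, u (i+1))` the third vertex of the inner triangular face containing this edge also lies
on the boundary cycle. -/
def Irreducible {h : ℕ} (u : ZMod h → ℝ × ℝ) : Prop :=
  (∃ v, G.IsInteriorVtx u v) ∧
  ∀ i : ZMod h, ∀ v ∈ G.verts,
    G.Adj (u i) v → G.Adj (u (i + 1)) v →
    G.IsFace (openTriangle (u i) (u (i + 1)) v) → v ∈ Set.range u

end PlaneGraph

namespace PlaneGraph

/-- A point of a triangle is a convex combination of the corners. -/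
theorem mem_convexHull_triple {a b c x : ℝ × ℝ} :
    x ∈ convexHull ℝ ({a, b, c} : Set (ℝ × ℝ)) ↔
      ∃ r s t : ℝ, 0 ≤ r ∧ 0 ≤ s ∧ 0 ≤ t ∧ r + s + t = 1 ∧ r • a + s • b + t • c = x := by
  constructor
  · rw [convexHull_insert (by simp), convexHull_pair, mem_convexJoin]
    rintro ⟨_, rfl, y, ⟨s, t, hs, ht, hst, rfl⟩, r, q, hr, hq, hrq, rfl⟩
    refine ⟨r, q * s, q * t, hr, by positivity, by positivity, ?_, ?_⟩
    · rw [add_assoc, ← mul_add, hst, mul_one, hrq]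
    · rw [smul_add, smul_smul, smul_smul, add_assoc]
  · rintro ⟨r, s, t, hr, hs, ht, hsum, rfl⟩
    have hc := convex_convexHull ℝ ({a, b, c} : Set (ℝ × ℝ))
    have hsub := subset_convexHull ℝ ({a, b, c} : Set (ℝ × ℝ))
    have := hc.sum_mem (t := Finset.univ) (w := ![r, s, t]) (z := ![a, b, c])
      (by simp [Fin.forall_fin_succ, hr, hs, ht]) (by simp [Fin.sum_univ_three, hsum])
      (by simpa [Fin.forall_fin_succ] using
        ⟨hsub (by simp), hsub (by simp), hsub (by simp)⟩)
    simpa [Fin.sum_univ_three] using this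

theorem mem_openTriangle_or_mem_side {a b c x : ℝ × ℝ} (hne : (openTriangle a b c).Nonempty)
    (hx : x ∈ convexHull ℝ ({a, b, c} : Set (ℝ × ℝ))) :
    x ∈ openTriangle a b c ∨ x ∈ segment ℝ a b ∨ x ∈ segment ℝ b c ∨ x ∈ segment ℝ a c := by
  obtain ⟨y, hy⟩ := hne
  obtain ⟨r', s', t', hr', hs', ht', hsum', rfl⟩ :=
    mem_convexHull_triple.1 (interior_subset hy)
  obtain ⟨r, s, t, hr, hs, ht, hsum, rfl⟩ := mem_convexHull_triple.1 hx
  rcases hr.eq_or_lt with rfl | hr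
  · exact Or.inr (Or.inr (Or.inl ⟨s, t, hs, ht, by linarith, by simp⟩))
  rcases hs.eq_or_lt with rfl | hs
  · exact Or.inr (Or.inr (Or.inr ⟨r, t, hr.le, ht, by linarith, by simp⟩))
  rcases ht.eq_or_lt with rfl | ht
  · exact Or.inr (Or.inl ⟨r, s, hr.le, hs.le, by linarith, by simp⟩)
  left
  obtain ⟨δ, hδ, hδr, hδs, hδt⟩ : ∃ δ > 0, δ ≤ r ∧ δ ≤ s ∧ δ ≤ t :=
    ⟨min r (min s t), by positivity, by simp, by simp, by simp⟩
  have hz : (r + δ * (r - r')) • a + (s + δ * (s - s')) • b + (t + δ * (t - t')) • c ∈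
      convexHull ℝ ({a, b, c} : Set (ℝ × ℝ)) :=
    mem_convexHull_triple.2 ⟨_, _, _, by nlinarith, by nlinarith, by nlinarith,
      by linear_combination (1 + δ) * hsum - δ * hsum', rfl⟩
  refine (convex_convexHull ℝ ({a, b, c} : Set (ℝ × ℝ))).openSegment_interior_closure_subset_interior
    hy (subset_closure hz) ⟨δ / (1 + δ), 1 / (1 + δ), by positivity, by positivity,
      by field_simp; ring, ?_⟩
  ext <;> simp <;> field_simp <;> ring

theorem closure_openTriangle_subset (a b c : ℝ × ℝ) :
    closure (openTriangle a b c) ⊆ convexHull ℝ ({a, b, c} : Set (ℝ × ℝ)) :=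
  closure_minimal interior_subset ((Set.toFinite _).isClosed_convexHull ℝ)

theorem closure_openTriangle {a b c : ℝ × ℝ} (hne : (openTriangle a b c).Nonempty) :
    closure (openTriangle a b c) = convexHull ℝ ({a, b, c} : Set (ℝ × ℝ)) := by
  rw [openTriangle, (convex_convexHull ℝ _).closure_interior_eq_closure_of_nonempty_interior hne,
    ((Set.toFinite _).isClosed_convexHull ℝ).closure_eq]

theorem isClosed_segment_prod (p q : ℝ × ℝ) : IsClosed (segment ℝ p q) := by
  rw [← closure_openSegment]; exact isClosed_closure

variable {G : PlaneGraph}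

theorem segment_subset_drawing {p q : ℝ × ℝ} (h : G.Adj p q) : segment ℝ p q ⊆ G.drawing :=
  fun _ hx => ⟨p, q, h, hx⟩

/-- The union of any family of edges of a finite plane graph is closed. -/
theorem isClosed_union_edges (P : ℝ × ℝ → ℝ × ℝ → Prop) (hP : ∀ p q, P p q → G.Adj p q) :
    IsClosed {x | ∃ p q, P p q ∧ x ∈ segment ℝ p q} := by
  have : {x | ∃ p q, P p q ∧ x ∈ segment ℝ p q} =
      ⋃ e ∈ (↑((G.verts ×ˢ G.verts).filter fun e => P e.1 e.2) :
        Set ((ℝ × ℝ) × (ℝ × ℝ))), segment ℝ e.1 e.2 := by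
    ext x
    constructor
    · rintro ⟨p, q, h, hx⟩
      exact Set.mem_biUnion (x := (p, q)) (by simpa [h] using G.mem_of_adj p q (hP p q h)) hx
    · intro hx
      obtain ⟨e, he, hx⟩ := Set.mem_iUnion₂.1 hx
      exact ⟨e.1, e.2, (Finset.mem_filter.1 he).2, hx⟩
  rw [this]
  exact (Finset.finite_toSet _).isClosed_biUnion fun e _ => isClosed_segment_prod _ _

theorem isClosed_drawing : IsClosed G.drawing := isClosed_union_edges G.Adj fun _ _ h => h

theorem isOpen_face (x : ℝ × ℝ) : IsOpen (connectedComponentIn G.drawingᶜ x) :=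
  isClosed_drawing.isOpen_compl.connectedComponentIn

theorem subset_outerRegion {S : Set (ℝ × ℝ)} (hS : IsPreconnected S) (hd : S ⊆ G.drawingᶜ)
    (hne : (S ∩ G.outerRegion).Nonempty) : S ⊆ G.outerRegion := by
  obtain ⟨x, hxS, hx⟩ := hne
  intro y hy
  have := connectedComponentIn_eq (hS.subset_connectedComponentIn hxS hd hy)
  exact ⟨hd hy, this ▸ hx.2⟩

theorem isOpen_outerRegion : IsOpen G.outerRegion := by
  rw [isOpen_iff_forall_mem_open]
  exact fun x hx => ⟨_, subset_outerRegion isPreconnected_connectedComponentIn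
    (connectedComponentIn_subset _ _) ⟨x, mem_connectedComponentIn hx.1, hx⟩,
    isOpen_face x, mem_connectedComponentIn hx.1⟩

theorem outerRegion_subset_compl : G.outerRegion ⊆ G.drawingᶜ := fun _ hx => hx.1

theorem IsEmbedded.eq_of_mem_openSegment (hG : G.IsEmbedded) {p q r s x : ℝ × ℝ}
    (hpq : G.Adj p q) (hrs : G.Adj r s) (hx : x ∈ openSegment ℝ p q) (hx' : x ∈ segment ℝ r s) :
    ({p, q} : Set (ℝ × ℝ)) = {r, s} := by
  rcases hG.1 p q r s hpq hrs x (openSegment_subset_segment ℝ _ _ hx) hx' with h | ⟨h, -⟩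
  · exact h
  · have hne : p ≠ q := fun h => G.loopless p (h ▸ hpq)
    rcases h with rfl | rfl
    · exact absurd (left_mem_openSegment_iff.1 hx) hne
    · exact absurd (right_mem_openSegment_iff.1 hx) hne

theorem IsEmbedded.eq_of_mem_openSegment_left (hG : G.IsEmbedded) {p q s x : ℝ × ℝ}
    (hpq : G.Adj p q) (hps : G.Adj p s) (hx : x ∈ openSegment ℝ p q) (hx' : x ∈ segment ℝ p s) :
    q = s := by
  have h := hG.eq_of_mem_openSegment hpq hps hx hx'
  have hq : q ∈ ({p, s} : Set (ℝ × ℝ)) := h ▸ by simp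
  rcases hq with rfl | rfl
  · exact absurd hpq (G.loopless _)
  · rfl

/-- A vertex on the boundary of a triangular face is a corner of it. -/
theorem IsEmbedded.eq_corner (hG : G.IsEmbedded) {a b c w : ℝ × ℝ} (hab : G.Adj a b)
    (hbc : G.Adj b c) (hac : G.Adj a c) (hne : (openTriangle a b c).Nonempty) (hw : w ∈ G.verts)
    (hw' : w ∈ closure (openTriangle a b c)) (hw'' : w ∉ openTriangle a b c) :
    w = a ∨ w = b ∨ w = c := by
  rcases mem_openTriangle_or_mem_side hne (closure_openTriangle_subset _ _ _ hw') with
    h | h | h | h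
  · exact absurd h hw''
  · have := hG.2 _ _ w hab hw h; tauto
  · have := hG.2 _ _ w hbc hw h; tauto
  · have := hG.2 _ _ w hac hw h; tauto

theorem openTriangle_rotate (a b c : ℝ × ℝ) : openTriangle a b c = openTriangle b c a := by
  unfold openTriangle
  congr 2
  ext; simp; tauto

/-- A triangular face having `w` as a corner, written with `w` in first position. -/
theorem exists_triangle_of_mem_closure (hG : G.IsEmbedded) {a b c w : ℝ × ℝ} (hab : G.Adj a b)
    (hbc : G.Adj b c) (hac : G.Adj a c) (hne : (openTriangle a b c).Nonempty) (hw : w ∈ G.verts)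
    (hw' : w ∈ closure (openTriangle a b c)) (hw'' : w ∉ openTriangle a b c) :
    ∃ p q, G.Adj w p ∧ G.Adj w q ∧ G.Adj p q ∧ openTriangle a b c = openTriangle w p q := by
  rcases hG.eq_corner hab hbc hac hne hw hw' hw'' with rfl | rfl | rfl
  · exact ⟨b, c, hab, hac, hbc, rfl⟩
  · exact ⟨c, a, hbc, G.symm _ _ hab, G.symm _ _ hac, openTriangle_rotate _ _ _⟩
  · exact ⟨a, b, G.symm _ _ hac, G.symm _ _ hbc, hab, (openTriangle_rotate _ _ _).symm⟩

/-- A vertex that is not an endpoint of an edge does not lie on the drawing of the rest of the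
graph. -/
theorem IsEmbedded.notMem_drawing_deleteVerts (hG : G.IsEmbedded) {w : ℝ × ℝ}
    (hw : w ∈ G.verts) : w ∉ (G.deleteVerts {w}).drawing := by
  rintro ⟨p, q, ⟨hpq, hp, hq⟩, hx⟩
  rcases hG.2 p q w hpq hw hx with rfl | rfl <;> simp_all

theorem IsEmbedded.deleteVerts (hG : G.IsEmbedded) (S : Finset (ℝ × ℝ)) :
    (G.deleteVerts S).IsEmbedded :=
  ⟨fun p q r s h h' => hG.1 p q r s h.1 h'.1,
    fun p q v h hv => hG.2 p q v h.1 (Finset.mem_sdiff.1 hv).1⟩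

theorem drawing_deleteVerts_subset (S : Finset (ℝ × ℝ)) :
    (G.deleteVerts S).drawing ⊆ G.drawing := fun _ ⟨p, q, h, hx⟩ => ⟨p, q, h.1, hx⟩

/-- A point of the drawing that is not drawn after deleting `w` is on an edge at `w`. -/
theorem exists_adj_of_notMem_drawing_deleteVerts {w x : ℝ × ℝ} (hx : x ∈ G.drawing)
    (hx' : x ∉ (G.deleteVerts {w}).drawing) : ∃ q, G.Adj w q ∧ x ∈ segment ℝ w q := by
  obtain ⟨p, q, hpq, hxs⟩ := hx
  by_cases hp : p = w
  · exact ⟨q, hp ▸ hpq, hp ▸ hxs⟩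
  by_cases hq : q = w
  · exact ⟨p, G.symm _ _ (hq ▸ hpq), by rw [segment_symm]; exact hq ▸ hxs⟩
  · exact absurd ⟨p, q, ⟨hpq, by simpa using hp, by simpa using hq⟩, hxs⟩ hx'

theorem segment_sub_subset {w q x : ℝ × ℝ} (hx : x ∈ segment ℝ w q) :
    segment ℝ w x ⊆ segment ℝ w q :=
  (convex_segment w q).segment_subset (left_mem_segment ℝ w q) hx

/-- Deleting a vertex on the boundary of the outer region merges the incident faces with the
outer region, so the bounded faces remain triangles. -/
theorem IsEmbedded.innerFacesTriangles_deleteVerts (hG : G.IsEmbedded)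
    (hF : G.InnerFacesTriangles) {w : ℝ × ℝ} (hw : w ∈ G.verts)
    (hwo : w ∈ closure G.outerRegion) : (G.deleteVerts {w}).InnerFacesTriangles := by
  rintro F ⟨x, hx, rfl⟩ hb
  set H := G.deleteVerts {w} with hH
  have hwH : w ∉ H.drawing := hG.notMem_drawing_deleteVerts hw
  have hsub : G.drawingᶜ ⊆ H.drawingᶜ :=
    Set.compl_subset_compl.2 (drawing_deleteVerts_subset _)
  have hwF : w ∉ connectedComponentIn H.drawingᶜ x := by
    intro hwF
    obtain ⟨y, hy, hyo⟩ := mem_closure_iff.1 hwo _ (isOpen_face x) hwF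
    refine hyo.2 (hb.subset ?_)
    rw [connectedComponentIn_eq hy]
    exact isPreconnected_connectedComponentIn.subset_connectedComponentIn
      (mem_connectedComponentIn hyo.1) ((connectedComponentIn_subset _ _).trans hsub)
  have hstar : connectedComponentIn H.drawingᶜ x ⊆ G.drawingᶜ := by
    intro y hy hyd
    have hyH := connectedComponentIn_subset _ _ hy
    obtain ⟨q, hq, hyq⟩ := exists_adj_of_notMem_drawing_deleteVerts hyd hyH
    have hseg : segment ℝ w y ⊆ H.drawingᶜ := by
      intro z hz hzd
      obtain ⟨p, r, hpr, hzs⟩ := hzd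
      have hzq := segment_sub_subset hyq hz
      rcases hG.1 w q p r hq hpr.1 z hzq hzs with h | ⟨h1, h2⟩
      · have : w ∈ ({p, r} : Set (ℝ × ℝ)) := h ▸ by simp
        rcases this with rfl | rfl
        · exact hpr.2.1 (by simp)
        · exact hpr.2.2 (by simp)
      · rcases h1 with rfl | rfl
        · exact hwH ⟨p, r, hpr, hzs⟩
        · have : y = z := (wbtw_swap_right_iff ℝ w).1
            ⟨mem_segment_iff_wbtw.1 hyq, mem_segment_iff_wbtw.1 hz⟩
          exact hyH ⟨p, r, hpr, this ▸ hzs⟩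
    refine hwF ?_
    rw [connectedComponentIn_eq hy]
    exact (convex_segment w y).isPreconnected.subset_connectedComponentIn
      (right_mem_segment _ _ _) hseg (left_mem_segment _ _ _)
  have heq : connectedComponentIn H.drawingᶜ x = connectedComponentIn G.drawingᶜ x :=
    Set.Subset.antisymm
      (isPreconnected_connectedComponentIn.subset_connectedComponentIn
        (mem_connectedComponentIn hx) hstar)
      (isPreconnected_connectedComponentIn.subset_connectedComponentIn
        (mem_connectedComponentIn (hstar (mem_connectedComponentIn hx)))
        ((connectedComponentIn_subset _ _).trans hsub))
  have hxG : x ∉ G.drawing := hstar (mem_connectedComponentIn hx)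
  obtain ⟨a, ha, b, hb', c, hc, hab, hbc, hac, hF'⟩ := hF _ ⟨x, hxG, rfl⟩ (heq ▸ hb)
  have hwcl : w ∉ closure (connectedComponentIn H.drawingᶜ x) := by
    intro hwcl
    obtain ⟨y, hy, hyF⟩ := mem_closure_iff.1 hwcl _ (isOpen_face w) (mem_connectedComponentIn hwH)
    apply hwF
    rw [connectedComponentIn_eq hyF, ← connectedComponentIn_eq hy]
    exact mem_connectedComponentIn hwH
  have hcorner : ∀ d ∈ ({a, b, c} : Set (ℝ × ℝ)), d ≠ w := by
    rintro d hd rfl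
    apply hwcl
    rw [heq, hF', closure_openTriangle (hF' ▸ ⟨x, mem_connectedComponentIn hxG⟩)]
    exact subset_convexHull ℝ _ hd
  have hwa : a ≠ w := hcorner a (by simp)
  have hwb : b ≠ w := hcorner b (by simp)
  have hwc : c ≠ w := hcorner c (by simp)
  refine ⟨a, ?_, b, ?_, c, ?_, ⟨hab, ?_, ?_⟩, ⟨hbc, ?_, ?_⟩, ⟨hac, ?_, ?_⟩, heq.trans hF'⟩ <;>
    simp_all [PlaneGraph.deleteVerts]

/-- The point at angle `θ` on the circle of radius `ε` about `w`. -/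
def circlePt (w : ℝ × ℝ) (ε θ : ℝ) : ℝ × ℝ := (w.1 + ε * Real.cos θ, w.2 + ε * Real.sin θ)

theorem continuous_circlePt (w : ℝ × ℝ) (ε : ℝ) : Continuous (circlePt w ε) := by
  unfold circlePt; fun_prop

theorem circlePt_add_two_pi (w : ℝ × ℝ) (ε θ : ℝ) :
    circlePt w ε (θ + 2 * Real.pi) = circlePt w ε θ := by simp [circlePt]

theorem circlePt_ne {w : ℝ × ℝ} {ε : ℝ} (hε : 0 < ε) (θ : ℝ) : circlePt w ε θ ≠ w := by
  intro h
  have h1 := congrArg Prod.fst h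
  have h2 := congrArg Prod.snd h
  simp [circlePt, hε.ne'] at h1 h2
  have := Real.sin_sq_add_cos_sq θ
  simp [h1, h2] at this

theorem dist_circlePt_le {w : ℝ × ℝ} {ε : ℝ} (hε : 0 < ε) (θ : ℝ) :
    dist (circlePt w ε θ) w ≤ ε := by
  simp only [circlePt, Prod.dist_eq, Real.dist_eq, add_sub_cancel_left, abs_mul, abs_of_pos hε]
  exact max_le (mul_le_of_le_one_right hε.le (Real.abs_cos_le_one θ))
    (mul_le_of_le_one_right hε.le (Real.abs_sin_le_one θ))

theorem mem_openSegment_iff_sub {w r x : ℝ × ℝ} : x ∈ openSegment ℝ w r ↔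
    ∃ t, 0 < t ∧ t < 1 ∧ x.1 - w.1 = t * (r.1 - w.1) ∧ x.2 - w.2 = t * (r.2 - w.2) := by
  constructor
  · rintro ⟨a, t, ha, ht, hat, rfl⟩
    obtain rfl : a = 1 - t := by linarith
    exact ⟨t, ht, by linarith, by simp; ring, by simp; ring⟩
  · rintro ⟨t, ht, ht1, h1, h2⟩
    refine ⟨1 - t, t, by linarith, ht, by ring, ?_⟩
    ext
    · simp; linarith
    · simp; linarith

theorem eq_of_mem_openSegment_circlePt {w r : ℝ × ℝ} {ε θ φ : ℝ} (hε : 0 < ε)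
    (hθ : circlePt w ε θ ∈ openSegment ℝ w r) (hφ : circlePt w ε φ ∈ openSegment ℝ w r)
    (h1 : θ - φ < 2 * Real.pi) (h2 : φ - θ < 2 * Real.pi) : θ = φ := by
  obtain ⟨t, ht, -, hx, hy⟩ := mem_openSegment_iff_sub.1 hθ
  obtain ⟨s, hs, -, hx', hy'⟩ := mem_openSegment_iff_sub.1 hφ
  simp only [circlePt, add_sub_cancel_left] at hx hy hx' hy'
  have hc : s * Real.cos θ = t * Real.cos φ := by
    apply mul_left_cancel₀ hε.ne'
    linear_combination s * hx - t * hx'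
  have hsn : s * Real.sin θ = t * Real.sin φ := by
    apply mul_left_cancel₀ hε.ne'
    linear_combination s * hy - t * hy'
  have hst : s = t := by
    have : s ^ 2 = t ^ 2 := by
      linear_combination (s * Real.cos θ + t * Real.cos φ) * hc +
        (s * Real.sin θ + t * Real.sin φ) * hsn - s ^ 2 * Real.sin_sq_add_cos_sq θ +
        t ^ 2 * Real.sin_sq_add_cos_sq φ
    exact (pow_left_inj₀ hs.le ht.le two_ne_zero).1 this
  subst hst
  obtain ⟨k, hk⟩ := Real.Angle.angle_eq_iff_two_pi_dvd_sub.1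
    (Real.Angle.cos_sin_inj (mul_left_cancel₀ hs.ne' hc) (mul_left_cancel₀ hs.ne' hsn))
  have hpi := Real.two_pi_pos
  have hk1 : (k : ℝ) < 1 := by nlinarith
  have hk2 : (-1 : ℝ) < k := by nlinarith
  have hk0 : k = 0 := by
    have h1 : k < 1 := by exact_mod_cast hk1
    have h2 : -1 < k := by exact_mod_cast hk2
    omega
  simp [hk0] at hk
  linarith

theorem exists_circlePt_mem_openSegment {w r : ℝ × ℝ} {ε : ℝ} (hε : 0 < ε) (hr : ε < dist r w)
    (θ₀ : ℝ) : ∃ θ ∈ Set.Ico θ₀ (θ₀ + 2 * Real.pi), circlePt w ε θ ∈ openSegment ℝ w r := by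
  set z : ℂ := ⟨r.1 - w.1, r.2 - w.2⟩ with hz
  have hzn : ε < ‖z‖ := by
    refine hr.trans_le ?_
    rw [Prod.dist_eq, Real.dist_eq, Real.dist_eq]
    exact max_le (Complex.abs_re_le_norm z) (Complex.abs_im_le_norm z)
  have hz0 : 0 < ‖z‖ := hε.trans hzn
  refine ⟨toIcoMod Real.two_pi_pos θ₀ z.arg, toIcoMod_mem_Ico _ _ _, ?_⟩
  have hper : circlePt w ε (toIcoMod Real.two_pi_pos θ₀ z.arg) = circlePt w ε z.arg := by
    have : Function.Periodic (circlePt w ε) (2 * Real.pi) := circlePt_add_two_pi w ε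
    exact this.sub_zsmul_eq _
  rw [hper, mem_openSegment_iff_sub]
  refine ⟨ε / ‖z‖, by positivity, (div_lt_one hz0).2 hzn, ?_, ?_⟩
  · have := Complex.norm_mul_cos_arg z
    have h' : z.re = r.1 - w.1 := rfl
    simp only [circlePt, add_sub_cancel_left, ← h', ← this]
    field_simp
  · have := Complex.norm_mul_sin_arg z
    have h' : z.im = r.2 - w.2 := rfl
    simp only [circlePt, add_sub_cancel_left, ← h', ← this]
    field_simp

/-- Within distance `ε` of `w` the drawing consists only of edges at `w`, and `w` is the only
vertex. -/
structure IsLocalRadius (G : PlaneGraph) (w : ℝ × ℝ) (ε : ℝ) : Prop where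
  pos : 0 < ε
  notMem_drawing : ∀ x, dist x w ≤ ε → x ∉ (G.deleteVerts {w}).drawing
  eq_of_mem_verts : ∀ x ∈ G.verts, dist x w ≤ ε → x = w

theorem IsEmbedded.exists_isLocalRadius (hG : G.IsEmbedded) {w : ℝ × ℝ} (hw : w ∈ G.verts) :
    ∃ ε, G.IsLocalRadius w ε := by
  have h1 : (G.deleteVerts {w}).drawingᶜ ∈ nhds w :=
    isClosed_drawing.isOpen_compl.mem_nhds (hG.notMem_drawing_deleteVerts hw)
  have h2 : ((G.verts.erase w : Finset (ℝ × ℝ)) : Set (ℝ × ℝ))ᶜ ∈ nhds w :=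
    (Finset.finite_toSet _).isClosed.isOpen_compl.mem_nhds (by simp)
  obtain ⟨ε, hε, h⟩ := Metric.nhds_basis_closedBall.mem_iff.1 (Filter.inter_mem h1 h2)
  refine ⟨ε, hε, fun x hx => (h hx).1, fun x hx hxd => ?_⟩
  have := (h hxd).2
  simp only [Finset.coe_erase, Set.mem_compl_iff, Set.mem_sdiff, Finset.mem_coe, not_and,
    Set.mem_singleton_iff, not_not] at this
  exact this hx

namespace IsLocalRadius

variable {w : ℝ × ℝ} {ε : ℝ} (hε : G.IsLocalRadius w ε)
include hε

theorem lt_dist {r : ℝ × ℝ} (hr : G.Adj w r) : ε < dist r w := by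
  by_contra! h
  have := hε.eq_of_mem_verts r (G.mem_of_adj _ _ hr).2 h
  exact G.loopless w (this ▸ hr)

theorem exists_adj {x : ℝ × ℝ} (hx : dist x w ≤ ε) (hxw : x ≠ w) (hxd : x ∈ G.drawing) :
    ∃ r, G.Adj w r ∧ x ∈ openSegment ℝ w r := by
  obtain ⟨r, hr, hxr⟩ := exists_adj_of_notMem_drawing_deleteVerts hxd (hε.notMem_drawing x hx)
  refine ⟨r, hr, mem_openSegment_of_ne_left_right hxw.symm ?_ hxr⟩
  rintro rfl
  exact absurd hx (hε.lt_dist hr).not_ge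

theorem exists_adj_circlePt {θ : ℝ} (h : circlePt w ε θ ∈ G.drawing) :
    ∃ r, G.Adj w r ∧ circlePt w ε θ ∈ openSegment ℝ w r :=
  hε.exists_adj (dist_circlePt_le hε.pos θ) (circlePt_ne hε.pos θ) h

theorem openSegment_subset_compl {θ : ℝ} (h : circlePt w ε θ ∉ G.drawing) :
    openSegment ℝ w (circlePt w ε θ) ⊆ G.drawingᶜ := by
  intro x hx hxd
  have hball : x ∈ Metric.closedBall w ε :=
    (convex_closedBall w ε).segment_subset (Metric.mem_closedBall_self hε.pos.le)
      (dist_circlePt_le hε.pos θ) (openSegment_subset_segment ℝ _ _ hx)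
  have hxw : x ≠ w := by
    rintro rfl
    exact circlePt_ne hε.pos θ (left_mem_openSegment_iff.1 hx).symm
  obtain ⟨r, hr, hxr⟩ := hε.exists_adj hball hxw hxd
  obtain ⟨t, ht, ht1, h1, h2⟩ := mem_openSegment_iff_sub.1 hxr
  obtain ⟨s, hs, hs1, h3, h4⟩ := mem_openSegment_iff_sub.1 hx
  rw [h1] at h3
  rw [h2] at h4
  by_cases hts : t / s ≤ 1
  · refine h ⟨w, r, hr, ?_⟩
    rw [segment_eq_image]
    refine ⟨t / s, ⟨by positivity, hts⟩, ?_⟩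
    ext
    · simp; field_simp; linarith
    · simp; field_simp; linarith
  · have hst : s / t ≤ 1 := by
      rw [div_le_one ht]
      rw [div_le_one hs] at hts
      linarith
    have hrb : r ∈ Metric.closedBall w ε := by
      refine (convex_closedBall w ε).segment_subset (Metric.mem_closedBall_self hε.pos.le)
        (dist_circlePt_le hε.pos θ) ?_
      rw [segment_eq_image]
      refine ⟨s / t, ⟨by positivity, hst⟩, ?_⟩
      ext
      · simp; field_simp; linarith
      · simp; field_simp; linarith
    exact absurd hrb (hε.lt_dist hr).not_ge

theorem mem_closure_face {θ : ℝ} (h : circlePt w ε θ ∉ G.drawing) :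
    w ∈ closure (connectedComponentIn G.drawingᶜ (circlePt w ε θ)) := by
  have hsub : insert (circlePt w ε θ) (openSegment ℝ w (circlePt w ε θ)) ⊆
      connectedComponentIn G.drawingᶜ (circlePt w ε θ) := by
    refine IsPreconnected.subset_connectedComponentIn ?_ (Set.mem_insert _ _)
      (Set.insert_subset h (hε.openSegment_subset_compl h))
    refine (convex_openSegment w _).isPreconnected.subset_closure (Set.subset_insert _ _) ?_
    rw [closure_openSegment]
    exact Set.insert_subset (right_mem_segment _ _ _) (openSegment_subset_segment ℝ _ _)
  refine closure_mono ((Set.subset_insert _ _).trans hsub) ?_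
  rw [closure_openSegment]
  exact left_mem_segment _ _ _

/-- A bounded face meeting the small circle about `w` is a triangle with corner `w`. -/
theorem exists_triangle (hG : G.IsEmbedded) (hF : G.InnerFacesTriangles) (hw : w ∈ G.verts)
    (hwd : w ∈ G.drawing) {θ : ℝ} (h : circlePt w ε θ ∉ G.drawing)
    (ho : circlePt w ε θ ∉ G.outerRegion) : ∃ p q, G.Adj w p ∧ G.Adj w q ∧ G.Adj p q ∧
      connectedComponentIn G.drawingᶜ (circlePt w ε θ) = openTriangle w p q := by
  have hb : Bornology.IsBounded (connectedComponentIn G.drawingᶜ (circlePt w ε θ)) := by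
    by_contra hb
    exact ho ⟨h, hb⟩
  obtain ⟨a, -, b, -, c, -, hab, hbc, hac, heq⟩ := hF _ ⟨_, h, rfl⟩ hb
  obtain ⟨p, q, hp, hq, hpq, heq'⟩ := exists_triangle_of_mem_closure hG hab hbc hac
    (heq ▸ ⟨_, mem_connectedComponentIn h⟩) hw (heq ▸ hε.mem_closure_face h)
    (fun hmem => by rw [← heq] at hmem; exact connectedComponentIn_subset _ _ hmem hwd)
  exact ⟨p, q, hp, hq, hpq, heq.trans heq'⟩

theorem eventually_notMem_drawing (θ₀ : ℝ) :
    ∀ᶠ θ in nhdsWithin θ₀ {θ₀}ᶜ, circlePt w ε θ ∉ G.drawing := by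
  have key : ∀ r ∈ G.verts, ∀ᶠ θ in nhdsWithin θ₀ {θ₀}ᶜ,
      G.Adj w r → circlePt w ε θ ∉ openSegment ℝ w r := by
    intro r _
    by_cases hr : G.Adj w r
    swap
    · exact Filter.Eventually.of_forall fun _ h => absurd h hr
    by_cases h : circlePt w ε θ₀ ∈ openSegment ℝ w r
    · have hnear : Set.Ioo (θ₀ - 2 * Real.pi) (θ₀ + 2 * Real.pi) ∈ nhds θ₀ :=
        Ioo_mem_nhds (by linarith [Real.pi_pos]) (by linarith [Real.pi_pos])
      filter_upwards [nhdsWithin_le_nhds hnear, self_mem_nhdsWithin] with θ hθ hne _ hmem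
      exact hne (eq_of_mem_openSegment_circlePt hε.pos hmem h
        (by linarith [hθ.2]) (by linarith [hθ.1]))
    · have hseg : circlePt w ε θ₀ ∉ segment ℝ w r := by
        intro hs
        refine h (mem_openSegment_of_ne_left_right (circlePt_ne hε.pos θ₀).symm ?_ hs)
        intro heq
        exact absurd (heq ▸ dist_circlePt_le hε.pos θ₀) (hε.lt_dist hr).not_ge
      have hopen : circlePt w ε ⁻¹' (segment ℝ w r)ᶜ ∈ nhds θ₀ :=
        ((isClosed_segment_prod w r).isOpen_compl.preimage (continuous_circlePt w ε)).mem_nhds hseg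
      filter_upwards [nhdsWithin_le_nhds hopen] with θ hθ _ hmem
      exact hθ (openSegment_subset_segment ℝ _ _ hmem)
  filter_upwards [(Filter.eventually_all_finset _).2 key] with θ hθ hd
  obtain ⟨r, hr, hmem⟩ := hε.exists_adj_circlePt hd
  exact hθ r (G.mem_of_adj _ _ hr).2 hr hmem

/-- Directions close to that of an edge at `w` point into faces incident with the edge. -/
theorem eventually_mem_closure_face (θ₀ : ℝ) : ∀ᶠ θ in nhdsWithin θ₀ {θ₀}ᶜ,
    circlePt w ε θ₀ ∈ closure (connectedComponentIn G.drawingᶜ (circlePt w ε θ)) := by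
  obtain ⟨l, u, ⟨hl, hu⟩, hsub⟩ := mem_nhds_iff_exists_Ioo_subset.1
    (eventually_nhdsWithin_iff.1 (hε.eventually_notMem_drawing θ₀))
  have key : ∀ I : Set ℝ, IsPreconnected I → I ⊆ Set.Ioo l u → θ₀ ∉ I → θ₀ ∈ closure I →
      ∀ θ ∈ I, circlePt w ε θ₀ ∈ closure (connectedComponentIn G.drawingᶜ (circlePt w ε θ)) := by
    intro I hI hIs hI0 hIc θ hθ
    have himg : circlePt w ε '' I ⊆ connectedComponentIn G.drawingᶜ (circlePt w ε θ) := by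
      refine (hI.image _ (continuous_circlePt w ε).continuousOn).subset_connectedComponentIn
        ⟨θ, hθ, rfl⟩ ?_
      rintro _ ⟨φ, hφ, rfl⟩
      exact hsub (hIs hφ) (fun h => hI0 (h ▸ hφ))
    exact closure_mono himg (image_closure_subset_closure_image (continuous_circlePt w ε)
      ⟨θ₀, hIc, rfl⟩)
  filter_upwards [nhdsWithin_le_nhds (Ioo_mem_nhds hl hu), self_mem_nhdsWithin] with θ hθ hne
  rcases lt_or_gt_of_ne (hne : θ ≠ θ₀) with h | h
  · refine key (Set.Ioo l θ₀) isPreconnected_Ioo (Set.Ioo_subset_Ioo_right hu.le) (by simp) ?_ θ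
      ⟨hθ.1, h⟩
    rw [closure_Ioo hl.ne]
    exact ⟨hl.le, le_rfl⟩
  · refine key (Set.Ioo θ₀ u) isPreconnected_Ioo (Set.Ioo_subset_Ioo_left hl.le) (by simp) ?_ θ
      ⟨h, hθ.2⟩
    rw [closure_Ioo hu.ne]
    exact ⟨le_rfl, hu.le⟩

end IsLocalRadius

theorem reachable_symm {p q : ℝ × ℝ} (h : G.Reachable p q) : G.Reachable q p := by
  induction h with
  | refl => exact .refl
  | tail _ h ih => exact (Relation.ReflTransGen.single (G.symm _ _ h)).trans ih

theorem adj_deleteVerts_pair {w v p q : ℝ × ℝ} (h : G.Adj p q) (hpw : p ≠ w) (hqw : q ≠ w)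
    (hpv : p ≠ v) (hqv : q ≠ v) : ((G.deleteVerts {w}).deleteVerts {v}).Adj p q :=
  ⟨⟨h, by simpa using hpw, by simpa using hqw⟩, by simpa using hpv, by simpa using hqv⟩

theorem ne_of_adj {p q : ℝ × ℝ} (h : G.Adj p q) : p ≠ q := by
  rintro rfl; exact G.loopless _ h

/-- The edge from `w` to `r ≠ v` passes through the point at angle `θ` of the small circle about
`w`, or is on the boundary of the face containing this point. -/
def IncidentAt (G : PlaneGraph) (w v : ℝ × ℝ) (ε θ : ℝ) (r : ℝ × ℝ) : Prop :=
  G.Adj w r ∧ r ≠ v ∧ (circlePt w ε θ ∈ openSegment ℝ w r ∨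
    circlePt w ε θ ∉ G.drawing ∧ ∃ x ∈ openSegment ℝ w r,
      x ∈ closure (connectedComponentIn G.drawingᶜ (circlePt w ε θ)))

/-- An edge at the corner `w` of a triangular face that is on the boundary of this face is a side
of it. -/
theorem IsEmbedded.eq_of_mem_closure_triangle (hG : G.IsEmbedded) {w p q r x : ℝ × ℝ}
    (hp : G.Adj w p) (hq : G.Adj w q) (hpq : G.Adj p q) (hr : G.Adj w r)
    (hne : (openTriangle w p q).Nonempty) (hd : openTriangle w p q ⊆ G.drawingᶜ)
    (hx : x ∈ openSegment ℝ w r) (hxc : x ∈ closure (openTriangle w p q)) : r = p ∨ r = q := by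
  rcases mem_openTriangle_or_mem_side hne (closure_openTriangle_subset _ _ _ hxc) with
    h | h | h | h
  · exact absurd (segment_subset_drawing hr (openSegment_subset_segment ℝ _ _ hx)) (hd h)
  · exact Or.inl (hG.eq_of_mem_openSegment_left hr hp hx h)
  · have heq := hG.eq_of_mem_openSegment hr hpq hx h
    have : w ∈ ({p, q} : Set (ℝ × ℝ)) := heq ▸ by simp
    rcases this with h | h
    · exact absurd h (ne_of_adj hp)
    · exact absurd h (ne_of_adj hq)
  · exact Or.inr (hG.eq_of_mem_openSegment_left hr hq hx h)

theorem midpoint_mem_openSegment_prod (p q : ℝ × ℝ) : midpoint ℝ p q ∈ openSegment ℝ p q :=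
  ⟨1 / 2, 1 / 2, by norm_num, by norm_num, by norm_num, by
    ext <;> simp [midpoint_eq_smul_add]⟩

section link

variable {w v : ℝ × ℝ} {ε : ℝ} (hG : G.IsEmbedded) (hF : G.InnerFacesTriangles)
  (hε : G.IsLocalRadius w ε) (hw : w ∈ G.verts) (hwd : w ∈ G.drawing)
include hG hF hε hw hwd

theorem IncidentAt.reachable {θ : ℝ} (ho : circlePt w ε θ ∉ G.outerRegion) {r s : ℝ × ℝ}
    (hr : G.IncidentAt w v ε θ r) (hs : G.IncidentAt w v ε θ s) :
    ((G.deleteVerts {w}).deleteVerts {v}).Reachable r s := by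
  obtain ⟨hwr, hrv, hr⟩ := hr
  obtain ⟨hws, hsv, hs⟩ := hs
  by_cases hd : circlePt w ε θ ∈ G.drawing
  · replace hr := hr.resolve_right fun h => h.1 hd
    replace hs := hs.resolve_right fun h => h.1 hd
    rw [hG.eq_of_mem_openSegment_left hwr hws hr (openSegment_subset_segment ℝ _ _ hs)]
    exact Relation.ReflTransGen.refl
  · have off : ∀ t, G.Adj w t → circlePt w ε θ ∉ openSegment ℝ w t := fun t ht h =>
      hd (segment_subset_drawing ht (openSegment_subset_segment ℝ _ _ h))
    obtain ⟨-, x, hx, hxc⟩ := hr.resolve_left (off r hwr)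
    obtain ⟨-, y, hy, hyc⟩ := hs.resolve_left (off s hws)
    obtain ⟨p, q, hp, hq, hpq, heq⟩ := hε.exists_triangle hG hF hw hwd hd ho
    have hne : (openTriangle w p q).Nonempty := heq ▸ ⟨_, mem_connectedComponentIn hd⟩
    have hsub : openTriangle w p q ⊆ G.drawingᶜ := heq ▸ connectedComponentIn_subset _ _
    rw [heq] at hxc hyc
    have h1 := hG.eq_of_mem_closure_triangle hp hq hpq hwr hne hsub hx hxc
    have h2 := hG.eq_of_mem_closure_triangle hp hq hpq hws hne hsub hy hyc
    by_cases hrs : r = s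
    · rw [hrs]; exact Relation.ReflTransGen.refl
    refine Relation.ReflTransGen.single
      (adj_deleteVerts_pair ?_ (ne_of_adj hwr).symm (ne_of_adj hws).symm hrv hsv)
    rcases h1 with rfl | rfl <;> rcases h2 with rfl | rfl
    · exact absurd rfl hrs
    · exact hpq
    · exact G.symm _ _ hpq
    · exact absurd rfl hrs

theorem exists_incidentAt {θ : ℝ} (ho : circlePt w ε θ ∉ G.outerRegion)
    (hv : G.Adj w v → circlePt w ε θ ∉ openSegment ℝ w v) : ∃ r, G.IncidentAt w v ε θ r := by
  by_cases hd : circlePt w ε θ ∈ G.drawing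
  · obtain ⟨r, hr, hmem⟩ := hε.exists_adj_circlePt hd
    exact ⟨r, hr, fun h => hv (h ▸ hr) (h ▸ hmem), Or.inl hmem⟩
  · obtain ⟨p, q, hp, hq, hpq, heq⟩ := hε.exists_triangle hG hF hw hwd hd ho
    have hne : (openTriangle w p q).Nonempty := heq ▸ ⟨_, mem_connectedComponentIn hd⟩
    have key : ∀ r ∈ ({w, p, q} : Set (ℝ × ℝ)), G.Adj w r → r ≠ v →
        G.IncidentAt w v ε θ r := by
      intro r hr hwr hrv
      refine ⟨hwr, hrv, Or.inr ⟨hd, midpoint ℝ w r, midpoint_mem_openSegment_prod w r, ?_⟩⟩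
      rw [heq, closure_openTriangle hne]
      exact segment_subset_convexHull (by simp) hr (midpoint_mem_segment w r)
    by_cases hpv : p = v
    · exact ⟨q, key q (by simp) hq fun h => ne_of_adj hpq (hpv.trans h.symm)⟩
    · exact ⟨p, key p (by simp) hp hpv⟩

/-- Rotating around `w` without meeting the outer region or the edge to `v`, all the edges passed
lead to neighbours of `w` that remain connected after deleting `w` and `v`. -/
theorem reachable_of_arc {I : Set ℝ} (hI : IsPreconnected I)
    (ho : ∀ θ ∈ I, circlePt w ε θ ∉ G.outerRegion)
    (hv : ∀ θ ∈ I, G.Adj w v → circlePt w ε θ ∉ openSegment ℝ w v) {θ φ : ℝ}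
    (hθ : θ ∈ I) (hφ : φ ∈ I) {r s : ℝ × ℝ} (hr : G.Adj w r) (hs : G.Adj w s)
    (hθr : circlePt w ε θ ∈ openSegment ℝ w r)
    (hφs : circlePt w ε φ ∈ openSegment ℝ w s) :
    ((G.deleteVerts {w}).deleteVerts {v}).Reachable r s := by
  refine hI.induction₂ (fun α β => ∀ r s, G.IncidentAt w v ε α r → G.IncidentAt w v ε β s →
    ((G.deleteVerts {w}).deleteVerts {v}).Reachable r s) ?_ ?_ ?_ hθ hφ r s
    ⟨hr, fun h => hv θ hθ (h ▸ hr) (h ▸ hθr), Or.inl hθr⟩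
    ⟨hs, fun h => hv φ hφ (h ▸ hs) (h ▸ hφs), Or.inl hφs⟩
  · intro α hα
    by_cases hd : circlePt w ε α ∈ G.drawing
    · obtain ⟨t, ht, hmem⟩ := hε.exists_adj_circlePt hd
      have htv : t ≠ v := fun h => hv α hα (h ▸ ht) (h ▸ hmem)
      have hαt : G.IncidentAt w v ε α t := ⟨ht, htv, Or.inl hmem⟩
      have h1 := eventually_nhdsWithin_iff.1 (hε.eventually_notMem_drawing α)
      have h2 := eventually_nhdsWithin_iff.1 (hε.eventually_mem_closure_face α)
      filter_upwards [nhdsWithin_le_nhds h1, nhdsWithin_le_nhds h2, self_mem_nhdsWithin]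
        with β hβ1 hβ2 hβ p q hp hq
      refine (hp.reachable hG hF hε hw hwd (ho α hα) hαt).trans ?_
      by_cases hβα : β = α
      · subst hβα
        exact hαt.reachable hG hF hε hw hwd (ho β hβ) hq
      · exact IncidentAt.reachable hG hF hε hw hwd (ho β hβ)
          ⟨ht, htv, Or.inr ⟨hβ1 hβα, _, hmem, hβ2 hβα⟩⟩ hq
    · have hnear : circlePt w ε ⁻¹' connectedComponentIn G.drawingᶜ (circlePt w ε α) ∈ nhds α :=
        ((isOpen_face _).preimage (continuous_circlePt w ε)).mem_nhds
          (mem_connectedComponentIn hd)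
      filter_upwards [nhdsWithin_le_nhds hnear, self_mem_nhdsWithin] with β hβ hβI p q hp hq
      have hβd : circlePt w ε β ∉ G.drawing := connectedComponentIn_subset _ _ hβ
      refine IncidentAt.reachable hG hF hε hw hwd (ho β hβI) ⟨hp.1, hp.2.1, Or.inr ⟨hβd, ?_⟩⟩ hq
      rw [← connectedComponentIn_eq hβ]
      exact (hp.2.2.resolve_left fun h =>
        hd (segment_subset_drawing hp.1 (openSegment_subset_segment ℝ _ _ h))).2
  · intro α β γ _ hβ _ h1 h2 p q hp hq
    obtain ⟨t, ht⟩ := exists_incidentAt hG hF hε hw hwd (ho β hβ) (hv β hβ)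
    exact (h1 p t hp ht).trans (h2 t q ht hq)
  · intro α β _ _ h p q hp hq
    exact reachable_symm (h q p hq hp)

/-- Two edges at `w` bound an arc that avoids the outer region: any further edge in this arc leads
to a neighbour of `w` connected to the end of one of the two edges in the graph without `w` and
`v`. -/
theorem reachable_end_of_arc {α β θ : ℝ} {a b r : ℝ × ℝ} (hθ : θ ∈ Set.Ioo α β)
    (hαβ : β - α < 2 * Real.pi)
    (ho : ∀ φ ∈ Set.Ioo α β, circlePt w ε φ ∉ G.outerRegion) (ha : G.Adj w a) (hb : G.Adj w b)
    (hr : G.Adj w r) (hα : circlePt w ε α ∈ openSegment ℝ w a)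
    (hβ : circlePt w ε β ∈ openSegment ℝ w b) (hθr : circlePt w ε θ ∈ openSegment ℝ w r)
    (hrv : r ≠ v) :
    (a ≠ v ∧ ((G.deleteVerts {w}).deleteVerts {v}).Reachable r a) ∨
      (b ≠ v ∧ ((G.deleteVerts {w}).deleteVerts {v}).Reachable r b) := by
  have hon : ∀ {t φ}, G.Adj w t → circlePt w ε φ ∈ openSegment ℝ w t →
      circlePt w ε φ ∉ G.outerRegion := fun ht h ho => outerRegion_subset_compl ho
    (segment_subset_drawing ht (openSegment_subset_segment ℝ _ _ h))
  have ho' : ∀ φ ∈ Set.Icc α β, circlePt w ε φ ∉ G.outerRegion := by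
    intro φ hφ
    rcases hφ.1.eq_or_lt with rfl | h1
    · exact hon ha hα
    rcases hφ.2.eq_or_lt with rfl | h2
    · exact hon hb hβ
    exact ho φ ⟨h1, h2⟩
  by_cases h : ∀ φ ∈ Set.Icc α θ, G.Adj w v → circlePt w ε φ ∉ openSegment ℝ w v
  · left
    refine ⟨fun hav => h α ⟨le_rfl, hθ.1.le⟩ (hav ▸ ha) (hav ▸ hα), ?_⟩
    exact reachable_of_arc hG hF hε hw hwd isPreconnected_Icc
      (fun φ hφ => ho' φ ⟨hφ.1, hφ.2.trans hθ.2.le⟩) h ⟨hθ.1.le, le_rfl⟩ ⟨le_rfl, hθ.1.le⟩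
      hr ha hθr hα
  · right
    push Not at h
    obtain ⟨φ, hφ, hv, hφv⟩ := h
    have hφθ : φ < θ := lt_of_le_of_ne hφ.2 fun h => hrv
      (hG.eq_of_mem_openSegment_left hv hr hφv (h ▸ openSegment_subset_segment ℝ _ _ hθr)).symm
    have h' : ∀ ψ ∈ Set.Icc θ β, G.Adj w v → circlePt w ε ψ ∉ openSegment ℝ w v := by
      intro ψ hψ _ hψv
      have h1 : φ = ψ := eq_of_mem_openSegment_circlePt hε.pos hφv hψv
        (by linarith [hψ.1, Real.pi_pos]) (by linarith [hψ.2, hφ.1, hψ.1, hθ.1, hθ.2])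
      linarith [hψ.1]
    refine ⟨fun hbv => h' β ⟨hθ.2.le, le_rfl⟩ hv (hbv ▸ hβ), ?_⟩
    exact reachable_of_arc hG hF hε hw hwd isPreconnected_Icc
      (fun φ hφ => ho' φ ⟨hθ.1.le.trans hφ.1, hφ.2⟩) h' ⟨le_rfl, hθ.2.le⟩ ⟨hθ.2.le, le_rfl⟩
      hr hb hθr hβ

end link

theorem IsEmbedded.notMem_drawing_deleteEdge (hG : G.IsEmbedded) {p q x : ℝ × ℝ}
    (hpq : G.Adj p q) (hx : x ∈ openSegment ℝ p q) : x ∉ (G.deleteEdge p q).drawing := by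
  rintro ⟨r, s, ⟨hrs, hne⟩, hxs⟩
  apply hne
  have := hG.eq_of_mem_openSegment hpq hrs hx hxs
  rcases Set.pair_eq_pair_iff.1 this with ⟨rfl, rfl⟩ | ⟨rfl, rfl⟩ <;> simp

/-- Near an interior point of an edge, either all or none of the points of the edge are in the
closure of the outer region. -/
theorem IsEmbedded.eventually_mem_closure_outerRegion_iff (hG : G.IsEmbedded) {p q x : ℝ × ℝ}
    (hpq : G.Adj p q) (hx : x ∈ openSegment ℝ p q) :
    ∀ᶠ y in nhdsWithin x (openSegment ℝ p q),
      x ∈ closure G.outerRegion ↔ y ∈ closure G.outerRegion := by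
  obtain ⟨δ, hδ, hball⟩ := Metric.isOpen_iff.1
    (isClosed_drawing (G := G.deleteEdge p q)).isOpen_compl x
    (hG.notMem_drawing_deleteEdge hpq hx)
  set ℓ : ℝ × ℝ → ℝ := fun z => (q.1 - p.1) * (z.2 - p.2) - (q.2 - p.2) * (z.1 - p.1) with hℓ
  set n : ℝ × ℝ := (-(q.2 - p.2), q.1 - p.1) with hn
  have hnorm : 0 < (q.1 - p.1) ^ 2 + (q.2 - p.2) ^ 2 := by
    by_contra! h
    have h1 : q.1 - p.1 = 0 := by nlinarith [sq_nonneg (q.1 - p.1), sq_nonneg (q.2 - p.2)]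
    have h2 : q.2 - p.2 = 0 := by nlinarith [sq_nonneg (q.1 - p.1), sq_nonneg (q.2 - p.2)]
    exact ne_of_adj hpq (Prod.ext (by linarith) (by linarith))
  have hℓn : ∀ z t, ℓ (z + t • n) = ℓ z + t * ((q.1 - p.1) ^ 2 + (q.2 - p.2) ^ 2) := by
    intro z t; simp [hℓ, hn]; ring
  have hℓseg : ∀ z ∈ segment ℝ p q, ℓ z = 0 := by
    rintro z ⟨a, b, ha, hb, hab, rfl⟩
    obtain rfl : a = 1 - b := by linarith
    simp [hℓ]; ring
  have hline : ∀ z (σ : ℝ), Filter.Tendsto (fun t : ℝ => z + (σ * t) • n)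
      (nhdsWithin 0 (Set.Ioi 0)) (nhds z) := by
    intro z σ
    have : Continuous fun t : ℝ => z + (σ * t) • n := by fun_prop
    exact (by simpa using this.tendsto 0 : Filter.Tendsto _ _ (nhds z)).mono_left
      nhdsWithin_le_nhds
  have hconv : ∀ σ : ℝ, Convex ℝ (Metric.ball x δ ∩ {z | 0 < σ * ℓ z}) := by
    intro σ
    refine (convex_ball x δ).inter ?_
    intro z hz y hy a b ha hb hab
    have hz' : 0 < σ * ℓ z := hz
    have hy' : 0 < σ * ℓ y := hy
    have : σ * ℓ (a • z + b • y) = a * (σ * ℓ z) + b * (σ * ℓ y) := by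
      obtain rfl : a = 1 - b := by linarith
      simp [hℓ]; ring
    change 0 < σ * ℓ (a • z + b • y)
    rw [this]
    rcases ha.eq_or_lt with rfl | ha
    · obtain rfl : b = 1 := by linarith
      simpa using hy'
    · nlinarith [mul_pos ha hz', mul_nonneg hb hy'.le]
  have hoff : ∀ z ∈ Metric.ball x δ, ℓ z ≠ 0 → z ∉ G.drawing := by
    rintro z hz hne ⟨r, s, hrs, hzs⟩
    by_cases h : (r = p ∧ s = q) ∨ (r = q ∧ s = p)
    · rcases h with ⟨rfl, rfl⟩ | ⟨rfl, rfl⟩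
      · exact hne (hℓseg z hzs)
      · exact hne (hℓseg z (by rwa [segment_symm]))
    · exact hball hz ⟨r, s, ⟨hrs, h⟩, hzs⟩
  have key : ∀ y ∈ Metric.ball x δ, ∀ z ∈ Metric.ball x δ, z ∈ segment ℝ p q →
      y ∈ closure G.outerRegion → z ∈ closure G.outerRegion := by
    intro y hy z hz hzs hyc
    obtain ⟨y', hy'b, hy'o⟩ := mem_closure_iff.1 hyc _ Metric.isOpen_ball hy
    obtain ⟨y₂, hy₂, hne⟩ : ∃ y₂ ∈ Metric.ball x δ ∩ G.outerRegion, ℓ y₂ ≠ 0 := by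
      by_cases h0 : ℓ y' = 0
      · obtain ⟨t, ht, ht0⟩ := (((hline y' 1).eventually
          ((Metric.isOpen_ball.inter isOpen_outerRegion).mem_nhds ⟨hy'b, hy'o⟩)).and
          self_mem_nhdsWithin).exists
        refine ⟨_, ht, ?_⟩
        rw [hℓn, h0]
        have : 0 < t := ht0
        positivity
      · exact ⟨y', ⟨hy'b, hy'o⟩, h0⟩
    obtain ⟨σ, hσ, hσ0⟩ : ∃ σ : ℝ, 0 < σ * ℓ y₂ ∧ 0 < σ * σ :=
      ⟨ℓ y₂, mul_self_pos.2 hne, mul_self_pos.2 hne⟩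
    have hsub : Metric.ball x δ ∩ {z | 0 < σ * ℓ z} ⊆ G.outerRegion :=
      subset_outerRegion (hconv σ).isPreconnected
        (fun z hz => hoff z hz.1 fun h => by
          have h2 : 0 < σ * ℓ z := hz.2
          simp [h] at h2) ⟨y₂, ⟨hy₂.1, hσ⟩, hy₂.2⟩
    refine mem_closure_of_tendsto (hline z σ) ?_
    filter_upwards [(hline z σ).eventually (Metric.isOpen_ball.mem_nhds hz), self_mem_nhdsWithin]
      with t ht ht0
    refine hsub ⟨ht, ?_⟩
    change 0 < σ * ℓ _
    rw [hℓn, hℓseg z hzs]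
    have : 0 < t := ht0
    have h3 : σ * (0 + σ * t * ((q.1 - p.1) ^ 2 + (q.2 - p.2) ^ 2)) =
      (σ * σ) * t * ((q.1 - p.1) ^ 2 + (q.2 - p.2) ^ 2) := by ring
    rw [h3]
    positivity
  filter_upwards [nhdsWithin_le_nhds (Metric.ball_mem_nhds x hδ), self_mem_nhdsWithin] with y hy hys
  have hxb := Metric.mem_ball_self (x := x) hδ
  exact ⟨key x hxb y hy (openSegment_subset_segment ℝ _ _ hys),
    key y hy x hxb (openSegment_subset_segment ℝ _ _ hx)⟩

/-- If an interior point of an edge is in the closure of the outer region, then so is the whole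
edge. -/
theorem IsEmbedded.segment_subset_closure_outerRegion (hG : G.IsEmbedded) {p q x : ℝ × ℝ}
    (hpq : G.Adj p q) (hx : x ∈ openSegment ℝ p q) (hxo : x ∈ closure G.outerRegion) :
    segment ℝ p q ⊆ closure G.outerRegion := by
  rw [← closure_openSegment]
  refine closure_minimal (fun y hy => ?_) isClosed_closure
  exact ((convex_openSegment p q).isPreconnected.induction₂
    (fun x y => x ∈ closure G.outerRegion ↔ y ∈ closure G.outerRegion)
    (fun z hz => hG.eventually_mem_closure_outerRegion_iff hpq hz)
    (fun _ _ _ _ _ _ h h' => h.trans h') (fun _ _ _ _ h => h.symm) hx hy).1 hxo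

/-- An arc of the small circle about `w` that meets no edge on the boundary of the outer region is
contained in the outer region or disjoint from it. -/
theorem IsLocalRadius.arc_outer_or_inner {w : ℝ × ℝ} {ε : ℝ} (hε : G.IsLocalRadius w ε)
    (hG : G.IsEmbedded) {I : Set ℝ} (hI : IsPreconnected I)
    (h : ∀ φ ∈ I, ∀ r, G.Adj w r → circlePt w ε φ ∈ openSegment ℝ w r →
      r ∉ closure G.outerRegion) :
    (∀ φ ∈ I, circlePt w ε φ ∈ G.outerRegion) ∨ ∀ φ ∈ I, circlePt w ε φ ∉ G.outerRegion := by
  have hc := continuous_circlePt w ε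
  have key : ∀ φ ∈ I, ∀ ψ ∈ I, circlePt w ε φ ∈ G.outerRegion ↔ circlePt w ε ψ ∈ G.outerRegion := by
    intro φ hφ ψ hψ
    refine hI.induction₂ (fun φ ψ => circlePt w ε φ ∈ G.outerRegion ↔
      circlePt w ε ψ ∈ G.outerRegion) (fun α hα => nhdsWithin_le_nhds ?_)
      (fun _ _ _ _ _ _ h h' => h.trans h') (fun _ _ _ _ h => h.symm) hφ hψ
    by_cases hd : circlePt w ε α ∈ G.drawing
    · obtain ⟨r, hr, hmem⟩ := hε.exists_adj_circlePt hd
      have hcl : circlePt w ε α ∈ (closure G.outerRegion)ᶜ := fun hcl => h α hα r hr hmem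
        (hG.segment_subset_closure_outerRegion hr hmem hcl (right_mem_segment _ _ _))
      filter_upwards [(isClosed_closure.isOpen_compl.preimage hc).mem_nhds hcl] with β hβ
      exact iff_of_false (fun ho => hcl (subset_closure ho)) fun ho => hβ (subset_closure ho)
    · filter_upwards [((isOpen_face _).preimage hc).mem_nhds (mem_connectedComponentIn hd)]
        with β hβ
      have hsub := connectedComponentIn_subset G.drawingᶜ (circlePt w ε α)
      exact ⟨fun ho => subset_outerRegion isPreconnected_connectedComponentIn hsub
          ⟨_, mem_connectedComponentIn hd, ho⟩ hβ,
        fun ho => subset_outerRegion isPreconnected_connectedComponentIn hsub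
          ⟨_, hβ, ho⟩ (mem_connectedComponentIn hd)⟩
  by_cases hex : ∃ φ ∈ I, circlePt w ε φ ∈ G.outerRegion
  · obtain ⟨φ, hφ, ho⟩ := hex
    exact Or.inl fun ψ hψ => (key φ hφ ψ hψ).1 ho
  · exact Or.inr fun ψ hψ ho => hex ⟨ψ, hψ, ho⟩

/-- A point of the plane as a complex number. -/
def toComplex (p : ℝ × ℝ) : ℂ := ⟨p.1, p.2⟩

theorem continuous_toComplex : Continuous toComplex :=
  Complex.equivRealProdCLM.symm.continuous

theorem toComplex_injective : Function.Injective toComplex := fun p q h => by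
  simpa [toComplex, Prod.ext_iff] using h

theorem tendsto_toComplex_cobounded :
    Filter.Tendsto toComplex (Bornology.cobounded (ℝ × ℝ)) (Bornology.cobounded ℂ) :=
  Complex.equivRealProdCLM.symm.antilipschitz.tendsto_cobounded

/-- The ratio of the vectors from `x` to `q` and to `p`. -/
def sideRatio (p q x : ℝ × ℝ) : ℂ := (toComplex q - toComplex x) / (toComplex p - toComplex x)

theorem sideRatio_mem_slitPlane {p q x : ℝ × ℝ} (hx : x ∉ segment ℝ p q) :
    sideRatio p q x ∈ Complex.slitPlane := by
  by_contra hs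
  rw [Complex.mem_slitPlane_iff, not_or, not_lt, not_not] at hs
  obtain ⟨hre, him⟩ := hs
  set s := -(sideRatio p q x).re with hs
  have hs0 : 0 ≤ s := by linarith
  have hr : sideRatio p q x = -(s : ℂ) := by
    apply Complex.ext <;> simp [hs, him]
  have hpx : toComplex p - toComplex x ≠ 0 := by
    rw [sub_ne_zero]
    intro h
    exact hx (toComplex_injective h ▸ left_mem_segment ℝ p q)
  rw [sideRatio, div_eq_iff hpx] at hr
  have h1 := congrArg Complex.re hr
  have h2 := congrArg Complex.im hr
  simp [toComplex] at h1 h2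
  refine hx ⟨s / (1 + s), 1 / (1 + s), by positivity, by positivity, by field_simp; ring, ?_⟩
  ext
  · simp; field_simp; linarith
  · simp; field_simp; linarith

theorem continuousAt_sideRatio {p q x : ℝ × ℝ} (hx : x ≠ p) : ContinuousAt (sideRatio p q) x := by
  have := continuous_toComplex.continuousAt (x := x)
  refine (continuousAt_const.sub this).div (continuousAt_const.sub this) ?_
  rw [sub_ne_zero]
  exact fun h => hx (toComplex_injective h).symm

theorem continuousAt_arg_sideRatio {p q x : ℝ × ℝ} (hx : x ∉ segment ℝ p q) :
    ContinuousAt (fun y => (sideRatio p q y).arg) x :=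
  (Complex.continuousAt_arg (sideRatio_mem_slitPlane hx)).comp
    (continuousAt_sideRatio fun h => hx (h ▸ left_mem_segment ℝ p q))

theorem tendsto_arg_sideRatio_cobounded (p q : ℝ × ℝ) :
    Filter.Tendsto (fun x => (sideRatio p q x).arg) (Bornology.cobounded (ℝ × ℝ)) (nhds 0) := by
  have h1 : Filter.Tendsto (fun x => toComplex p - toComplex x) (Bornology.cobounded (ℝ × ℝ))
      (Bornology.cobounded ℂ) :=
    (tendsto_const_sub_cobounded _).comp tendsto_toComplex_cobounded
  have h2 : Filter.Tendsto (sideRatio p q) (Bornology.cobounded (ℝ × ℝ)) (nhds 1) := by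
    have h3 := ((Filter.tendsto_inv₀_cobounded.comp h1).const_mul
      (toComplex q - toComplex p)).const_add 1
    rw [mul_zero, add_zero] at h3
    refine h3.congr' ?_
    filter_upwards [h1.eventually (Bornology.eventually_ne_cobounded 0)] with x hx
    have hx0 : toComplex p - toComplex x ≠ 0 := hx
    simp only [sideRatio, Function.comp_apply]
    field_simp
    ring
  have h4 := (Complex.continuousAt_arg Complex.one_mem_slitPlane).tendsto.comp h2
  rwa [Complex.arg_one] at h4

/-- The winding angle of the closed polygon `u` about `x`. -/
def windingAngle {h : ℕ} [NeZero h] (u : ZMod h → ℝ × ℝ) (x : ℝ × ℝ) : ℝ :=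
  ∑ k, (sideRatio (u k) (u (k + 1)) x).arg

theorem cos_windingAngle {h : ℕ} [NeZero h] {u : ZMod h → ℝ × ℝ} {x : ℝ × ℝ}
    (hx : ∀ k, x ≠ u k) : Real.cos (windingAngle u x) = 1 := by
  have hne : ∀ k, toComplex (u k) - toComplex x ≠ 0 := fun k => by
    rw [sub_ne_zero]
    exact fun h => hx k (toComplex_injective h).symm
  have hprod : ∏ k, sideRatio (u k) (u (k + 1)) x = 1 := by
    simp only [sideRatio, Finset.prod_div_distrib]
    rw [div_eq_one_iff_eq (Finset.prod_ne_zero_iff.2 fun k _ => hne k)]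
    exact Fintype.prod_equiv (Equiv.addRight (1 : ZMod h)) _ _ fun k => rfl
  have hexp : Complex.exp ((windingAngle u x : ℝ) * Complex.I) = 1 := by
    have h1 : ∏ k, ((‖sideRatio (u k) (u (k + 1)) x‖ : ℂ) *
        Complex.exp ((sideRatio (u k) (u (k + 1)) x).arg * Complex.I)) = 1 := by
      simp only [Complex.norm_mul_exp_arg_mul_I, hprod]
    rw [Finset.prod_mul_distrib, ← Complex.ofReal_prod, ← norm_prod, hprod,
      ← Complex.exp_sum, ← Finset.sum_mul, ← Complex.ofReal_sum] at h1
    simpa [windingAngle] using h1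
  have := congrArg Complex.re hexp
  rwa [Complex.exp_ofReal_mul_I_re, Complex.one_re] at this

theorem windingAngle_eq_zero {h : ℕ} [NeZero h] {u : ZMod h → ℝ × ℝ}
    (hadj : ∀ k, G.Adj (u k) (u (k + 1))) {x : ℝ × ℝ} (hx : x ∈ G.outerRegion) :
    windingAngle u x = 0 := by
  set S := connectedComponentIn G.drawingᶜ x
  have hS : ∀ y ∈ S, ∀ k, y ∉ segment ℝ (u k) (u (k + 1)) := fun y hy k hk =>
    connectedComponentIn_subset _ _ hy (segment_subset_drawing (hadj k) hk)
  have hcos : ∀ y ∈ S, Real.cos (windingAngle u y) = 1 := fun y hy =>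
    cos_windingAngle fun k hk => hS y hy k (hk ▸ left_mem_segment ℝ _ _)
  have hcont : ContinuousOn (fun y => |windingAngle u y|) S := by
    refine ContinuousOn.abs (continuousOn_finsetSum _ fun k _ y hy => ?_)
    exact (continuousAt_arg_sideRatio (hS y hy k)).continuousWithinAt
  have hfar : Filter.Tendsto (fun y => |windingAngle u y|) (Bornology.cobounded (ℝ × ℝ))
      (nhds 0) := by
    have := (tendsto_finsetSum Finset.univ fun k _ =>
      tendsto_arg_sideRatio_cobounded (u k) (u (k + 1))).abs
    simpa [windingAngle] using this
  obtain ⟨y, hyS, hy⟩ : ∃ y ∈ S, |windingAngle u y| < Real.pi := by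
    by_contra! hcon
    refine hx.2 (Bornology.isBounded_def.2 ?_)
    filter_upwards [hfar.eventually (gt_mem_nhds Real.pi_pos)] with y hy hyS
    exact (hcon y hyS).not_gt hy
  have hxS : x ∈ S := mem_connectedComponentIn hx.1
  have hlt : |windingAngle u x| < Real.pi := by
    by_contra! hge
    obtain ⟨z, hz, hzπ⟩ := isPreconnected_connectedComponentIn.intermediate_value hyS hxS hcont
      ⟨hy.le, hge⟩
    have := hcos z hz
    rw [← Real.cos_abs] at this
    simp only at hzπ
    rw [hzπ, Real.cos_pi] at this
    norm_num at this
  have hpi := Real.pi_pos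
  obtain ⟨h1, h2⟩ := abs_lt.1 hlt
  exact (Real.cos_eq_one_iff_of_lt_of_lt (by linarith) (by linarith)).1 (hcos x hxS)

theorem two_ne_zero_zmod {h : ℕ} (hh : 3 ≤ h) : (2 : ZMod h) ≠ 0 := by
  intro h2
  have : ((2 : ℕ) : ZMod h) = 0 := by exact_mod_cast h2
  exact absurd (Nat.le_of_dvd two_pos ((ZMod.natCast_eq_zero_iff _ _).1 this)) (by omega)

/-- An interior point of a side of an embedded polygon is on no other side. -/
theorem IsEmbedded.notMem_segment_side (hG : G.IsEmbedded) {h : ℕ} {u : ZMod h → ℝ × ℝ}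
    (hu : G.IsBoundaryCycle u) {i k : ZMod h} (hk : k ≠ i) {x : ℝ × ℝ}
    (hx : x ∈ openSegment ℝ (u i) (u (i + 1))) : x ∉ segment ℝ (u k) (u (k + 1)) := by
  obtain ⟨hh, hinj, -, hadj, -, -⟩ := hu
  intro hxk
  rcases hG.1 _ _ _ _ (hadj i) (hadj k) x (openSegment_subset_segment ℝ _ _ hx) hxk with he | he
  · have h1 : u i ∈ ({u k, u (k + 1)} : Set (ℝ × ℝ)) := he ▸ by simp
    have h2 : u (i + 1) ∈ ({u k, u (k + 1)} : Set (ℝ × ℝ)) := he ▸ by simp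
    simp only [Set.mem_insert_iff, Set.mem_singleton_iff, hinj.eq_iff] at h1 h2
    rcases h1 with h1 | h1
    · exact hk h1.symm
    · rcases h2 with h2 | h2
      · exact two_ne_zero_zmod hh (by linear_combination h2 - h1)
      · exact hk (add_right_cancel h2).symm
  · have hne : u i ≠ u (i + 1) := fun h => G.loopless _ (h ▸ hadj i)
    rcases he.1 with rfl | rfl
    · exact hne (left_mem_openSegment_iff.1 hx)
    · exact hne (right_mem_openSegment_iff.1 hx)

theorem sideRatio_circlePt {w b : ℝ × ℝ} {ε θ₀ : ℝ} (hε : 0 < ε)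
    (hθ₀ : circlePt w ε θ₀ ∈ openSegment ℝ w b) :
    ∃ c : ℝ, 1 < c ∧ ∀ θ, sideRatio w b (circlePt w ε θ) =
      1 - c * Complex.exp ((θ₀ - θ : ℝ) * Complex.I) := by
  obtain ⟨t, ht, ht1, h1, h2⟩ := mem_openSegment_iff_sub.1 hθ₀
  simp only [circlePt, add_sub_cancel_left] at h1 h2
  refine ⟨t⁻¹, (one_lt_inv₀ ht).2 ht1, fun θ => ?_⟩
  have hb : toComplex b - toComplex w = t⁻¹ * ε * Complex.exp (θ₀ * Complex.I) := by
    apply Complex.ext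
    · rw [mul_assoc, Complex.re_ofReal_mul, Complex.re_ofReal_mul, Complex.exp_ofReal_mul_I_re, h1]
      simp [toComplex]; field_simp
    · rw [mul_assoc, Complex.im_ofReal_mul, Complex.im_ofReal_mul, Complex.exp_ofReal_mul_I_im, h2]
      simp [toComplex]; field_simp
  have hm : toComplex (circlePt w ε θ) = toComplex w + ε * Complex.exp (θ * Complex.I) := by
    apply Complex.ext
    · rw [Complex.add_re, Complex.re_ofReal_mul, Complex.exp_ofReal_mul_I_re]
      simp [toComplex, circlePt]
    · rw [Complex.add_im, Complex.im_ofReal_mul, Complex.exp_ofReal_mul_I_im]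
      simp [toComplex, circlePt]
  have hε' : (ε : ℂ) ≠ 0 := by exact_mod_cast hε.ne'
  have he := Complex.exp_ne_zero (θ * Complex.I)
  rw [sideRatio, hm, div_eq_iff (by simpa using hε.ne'),
    show toComplex b - (toComplex w + ε * Complex.exp (θ * Complex.I)) =
      (toComplex b - toComplex w) - ε * Complex.exp (θ * Complex.I) by ring, hb,
    Complex.ofReal_sub, sub_mul (θ₀ : ℂ), Complex.exp_sub]
  field_simp
  ring

/-- The outer region is not on both sides of an edge of the boundary cycle. -/
theorem IsEmbedded.not_eventually_outerRegion (hG : G.IsEmbedded) {h : ℕ} {u : ZMod h → ℝ × ℝ}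
    (hu : G.IsBoundaryCycle u) {i : ZMod h} {ε θ₀ : ℝ} (hε : 0 < ε)
    (hθ₀ : circlePt (u i) ε θ₀ ∈ openSegment ℝ (u i) (u (i + 1))) :
    ¬ ∀ᶠ θ in nhdsWithin θ₀ {θ₀}ᶜ, circlePt (u i) ε θ ∈ G.outerRegion := by
  intro hout
  have : NeZero h := ⟨by have := hu.1; omega⟩
  obtain ⟨c, hc, hz⟩ := sideRatio_circlePt hε hθ₀
  have hcirc := (continuous_circlePt (u i) ε).continuousAt (x := θ₀)
  set R : ℝ → ℝ := fun θ => -∑ k ∈ Finset.univ.erase i,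
    (sideRatio (u k) (u (k + 1)) (circlePt (u i) ε θ)).arg with hR
  have hRc : ContinuousAt R θ₀ := by
    refine (tendsto_finsetSum _ fun k hk => ?_).neg
    exact (continuousAt_arg_sideRatio
      (hG.notMem_segment_side hu (Finset.ne_of_mem_erase hk) hθ₀)).tendsto.comp hcirc
  have hlim : Filter.Tendsto (fun θ => (sideRatio (u i) (u (i + 1)) (circlePt (u i) ε θ)).arg)
      (nhdsWithin θ₀ {θ₀}ᶜ) (nhds (R θ₀)) := by
    refine (hRc.tendsto.mono_left nhdsWithin_le_nhds).congr' ?_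
    filter_upwards [hout] with θ hθ
    have := windingAngle_eq_zero hu.2.2.2.1 hθ
    rw [windingAngle, ← Finset.add_sum_erase _ _ (Finset.mem_univ i)] at this
    simp only [hR]
    linarith
  have hre : (sideRatio (u i) (u (i + 1)) (circlePt (u i) ε θ₀)).re < 0 := by
    rw [hz]; simp; linarith
  have him : (sideRatio (u i) (u (i + 1)) (circlePt (u i) ε θ₀)).im = 0 := by
    rw [hz]; simp
  have him' : ∀ θ, (sideRatio (u i) (u (i + 1)) (circlePt (u i) ε θ)).im =
      c * Real.sin (θ - θ₀) := fun θ => by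
    rw [hz, Complex.sub_im, Complex.im_ofReal_mul, Complex.exp_ofReal_mul_I_im, Complex.one_im,
      ← neg_sub θ θ₀, Real.sin_neg]
    ring
  have hcont : ContinuousAt (fun θ => sideRatio (u i) (u (i + 1)) (circlePt (u i) ε θ)) θ₀ :=
    (continuousAt_sideRatio (circlePt_ne hε θ₀)).comp hcirc
  have hpi := Real.pi_pos
  have h1 := (Complex.tendsto_arg_nhdsWithin_im_neg_of_re_neg_of_im_zero hre him).comp
    (tendsto_nhdsWithin_iff.2 ⟨hcont.tendsto.mono_left nhdsWithin_le_nhds, by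
      filter_upwards [Ioo_mem_nhdsLT (show θ₀ - Real.pi < θ₀ by linarith)] with θ hθ
      rw [him']
      exact mul_neg_of_pos_of_neg (by linarith)
        (Real.sin_neg_of_neg_of_neg_pi_lt (by linarith [hθ.2]) (by linarith [hθ.1]))⟩ :
      Filter.Tendsto _ (nhdsWithin θ₀ (Set.Iio θ₀)) _)
  have h2 := (Complex.tendsto_arg_nhdsWithin_im_nonneg_of_re_neg_of_im_zero hre him).comp
    (tendsto_nhdsWithin_iff.2 ⟨hcont.tendsto.mono_left nhdsWithin_le_nhds, by
      filter_upwards [Ioo_mem_nhdsGT (show θ₀ < θ₀ + Real.pi by linarith)] with θ hθ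
      rw [him']
      exact mul_nonneg (by linarith)
        (Real.sin_nonneg_of_nonneg_of_le_pi (by linarith [hθ.1]) (by linarith [hθ.2]))⟩ :
      Filter.Tendsto _ (nhdsWithin θ₀ (Set.Ioi θ₀)) _)
  have h3 := tendsto_nhds_unique h1
    (hlim.mono_left (nhdsWithin_mono _ fun θ (hθ : θ < θ₀) => hθ.ne))
  have h4 := tendsto_nhds_unique h2
    (hlim.mono_left (nhdsWithin_mono _ fun θ (hθ : θ₀ < θ) => hθ.ne'))
  linarith

/-- If a boundary cycle has no diagonals, a neighbour of `u i` on the outer face is `u (i - 1)`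
or `u (i + 1)`. -/
theorem IsBoundaryCycle.eq_of_adj {h : ℕ} {u : ZMod h → ℝ × ℝ} (hu : G.IsBoundaryCycle u)
    (hnd : G.HasNoDiagonals u) {i : ZMod h} {r : ℝ × ℝ} (hr : G.Adj (u i) r)
    (hro : r ∈ closure G.outerRegion) : r = u (i - 1) ∨ r = u (i + 1) := by
  have hrf : r ∈ frontier G.outerRegion := by
    rw [frontier, isOpen_outerRegion.interior_eq]
    exact ⟨hro, fun h => outerRegion_subset_compl h
      (segment_subset_drawing hr (right_mem_segment ℝ _ _))⟩
  obtain ⟨j, rfl⟩ := hu.2.2.2.2.2 r (G.mem_of_adj _ _ hr).2 hrf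
  rcases hnd i j hr with rfl | rfl
  · exact Or.inr rfl
  · exact Or.inl (by rw [add_sub_cancel_right])

theorem IsBoundaryCycle.adj_sub_one {h : ℕ} {u : ZMod h → ℝ × ℝ} (hu : G.IsBoundaryCycle u)
    (i : ZMod h) : G.Adj (u i) (u (i - 1)) := by
  have := hu.2.2.2.1 (i - 1)
  rw [sub_add_cancel] at this
  exact G.symm _ _ this

theorem IsBoundaryCycle.sub_one_ne_add_one {h : ℕ} {u : ZMod h → ℝ × ℝ}
    (hu : G.IsBoundaryCycle u) (i : ZMod h) : u (i - 1) ≠ u (i + 1) := fun he =>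
  two_ne_zero_zmod hu.1 (by linear_combination -hu.2.1 he)

/-- The two cycle neighbours of `u i` are joined by the rest of the cycle. -/
theorem IsBoundaryCycle.reachable_of_notMem_range {h : ℕ} {u : ZMod h → ℝ × ℝ}
    (hu : G.IsBoundaryCycle u) (i : ZMod h) {v : ℝ × ℝ} (hv : v ∉ Set.range u) :
    ((G.deleteVerts {u i}).deleteVerts {v}).Reachable (u (i + 1)) (u (i - 1)) := by
  obtain ⟨hh, hinj, -, hadj, -, -⟩ := hu
  have hne : ∀ n : ℕ, n + 1 < h → u (i + 1 + n) ≠ u i := fun n hn he => by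
    have h1 : ((n + 1 : ℕ) : ZMod h) = 0 := by
      push_cast
      linear_combination hinj he
    exact absurd (Nat.le_of_dvd n.succ_pos ((ZMod.natCast_eq_zero_iff _ _).1 h1)) (by omega)
  have key : ∀ n : ℕ, n + 1 < h →
      ((G.deleteVerts {u i}).deleteVerts {v}).Reachable (u (i + 1)) (u (i + 1 + n)) := by
    intro n
    induction n with
    | zero => intro _; rw [Nat.cast_zero, add_zero]; exact .refl
    | succ n ih =>
      intro hn
      have hs : i + 1 + ((n + 1 : ℕ) : ZMod h) = i + 1 + n + 1 := by push_cast; ring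
      have h1 := hne (n + 1) hn
      rw [hs] at h1 ⊢
      exact (ih (by omega)).tail (adj_deleteVerts_pair (hadj _) (hne n (by omega)) h1
        (fun he => hv ⟨_, he⟩) (fun he => hv ⟨_, he⟩))
  have h2 := key (h - 2) (by omega)
  rwa [Nat.cast_sub (by omega), ZMod.natCast_self, Nat.cast_ofNat,
    show i + 1 + (0 - 2) = i - 1 by ring] at h2

/-- The neighbours of a boundary vertex `u i` remain connected after deletion of `u i` and one
further vertex. -/
theorem IsBoundaryCycle.reachable_neighbors (hG : G.IsEmbedded) (hF : G.InnerFacesTriangles)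
    {h : ℕ} {u : ZMod h → ℝ × ℝ} (hu : G.IsBoundaryCycle u) (hnd : G.HasNoDiagonals u)
    {i : ZMod h} {v r s : ℝ × ℝ} (hvi : v ≠ u i) (hr : G.Adj (u i) r) (hs : G.Adj (u i) s)
    (hrv : r ≠ v) (hsv : s ≠ v) :
    ((G.deleteVerts {u i}).deleteVerts {v}).Reachable r s := by
  have hw := hu.2.2.1 i
  have ha := hu.adj_sub_one i
  have hb := hu.2.2.2.1 i
  have hab := hu.sub_one_ne_add_one i
  have hout := fun r hr => hu.eq_of_adj hnd (i := i) (r := r) hr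
  have hwd : u i ∈ G.drawing := segment_subset_drawing hb (left_mem_segment ℝ _ _)
  obtain ⟨ε, hε⟩ := hG.exists_isLocalRadius hw
  obtain ⟨α, -, hα⟩ := exists_circlePt_mem_openSegment hε.pos (hε.lt_dist ha) 0
  obtain ⟨β, hβ, hβb⟩ := exists_circlePt_mem_openSegment hε.pos (hε.lt_dist hb) α
  have hα' : circlePt (u i) ε (α + 2 * Real.pi) ∈ openSegment ℝ (u i) (u (i - 1)) := by
    rwa [circlePt_add_two_pi]
  have huniq : ∀ θ r s, G.Adj (u i) r → G.Adj (u i) s → circlePt (u i) ε θ ∈ openSegment ℝ (u i) r →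
      circlePt (u i) ε θ ∈ openSegment ℝ (u i) s → r = s := fun θ r s hr hs h1 h2 =>
    hG.eq_of_mem_openSegment_left hr hs h1 (openSegment_subset_segment ℝ _ _ h2)
  have hαβ : α < β := lt_of_le_of_ne hβ.1 fun he => hab (huniq α _ _ ha hb hα (he ▸ hβb))
  have hnotouter : ∀ θ r, G.Adj (u i) r → circlePt (u i) ε θ ∈ openSegment ℝ (u i) r →
      circlePt (u i) ε θ ∉ G.outerRegion := fun θ r hr hθ ho =>
    outerRegion_subset_compl ho (segment_subset_drawing hr (openSegment_subset_segment ℝ _ _ hθ))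
  have hnoa : ∀ θ ∈ Set.Ioo α (α + 2 * Real.pi),
      circlePt (u i) ε θ ∉ openSegment ℝ (u i) (u (i - 1)) := fun θ hθ hc =>
    hθ.1.ne' (eq_of_mem_openSegment_circlePt hε.pos hc hα (by linarith [hθ.2])
      (by linarith [hθ.1, Real.pi_pos]))
  have hnob : ∀ θ ∈ Set.Ioo α (α + 2 * Real.pi), θ ≠ β →
      circlePt (u i) ε θ ∉ openSegment ℝ (u i) (u (i + 1)) := fun θ hθ hne hc =>
    hne (eq_of_mem_openSegment_circlePt hε.pos hc hβb (by linarith [hθ.2, hβ.1])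
      (by linarith [hθ.1, hβ.2]))
  have hsub₁ : Set.Ioo α β ⊆ Set.Ioo α (α + 2 * Real.pi) := Set.Ioo_subset_Ioo_right hβ.2.le
  have hsub₂ : Set.Ioo β (α + 2 * Real.pi) ⊆ Set.Ioo α (α + 2 * Real.pi) :=
    Set.Ioo_subset_Ioo_left hαβ.le
  have harc : ∀ I : Set ℝ, IsPreconnected I → I ⊆ Set.Ioo α (α + 2 * Real.pi) → β ∉ I →
      (∀ φ ∈ I, circlePt (u i) ε φ ∈ G.outerRegion) ∨
        ∀ φ ∈ I, circlePt (u i) ε φ ∉ G.outerRegion := fun I hI hsub hβI =>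
    hε.arc_outer_or_inner hG hI fun φ hφ r hr hφr hro => by
      rcases hout r hr hro with rfl | rfl
      · exact hnoa φ (hsub hφ) hφr
      · exact hnob φ (hsub hφ) (fun he => hβI (he ▸ hφ)) hφr
  have harc₁ := harc _ isPreconnected_Ioo hsub₁ fun h => h.2.false
  have harc₂ := harc _ isPreconnected_Ioo hsub₂ fun h => h.1.false
  have hend : ∀ r, G.Adj (u i) r → r ≠ v →
      (u (i - 1) ≠ v ∧ ((G.deleteVerts {u i}).deleteVerts {v}).Reachable r (u (i - 1))) ∨
      (u (i + 1) ≠ v ∧ ((G.deleteVerts {u i}).deleteVerts {v}).Reachable r (u (i + 1))) := by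
    intro r hr hrv
    obtain ⟨θ, hθ, hθr⟩ := exists_circlePt_mem_openSegment hε.pos (hε.lt_dist hr) α
    rcases hθ.1.eq_or_lt with rfl | hαθ
    · obtain rfl := huniq _ _ _ hr ha hθr hα
      exact Or.inl ⟨hrv, .refl⟩
    rcases lt_trichotomy θ β with hθβ | rfl | hθβ
    · exact reachable_end_of_arc hG hF hε hw hwd ⟨hαθ, hθβ⟩ (by linarith [hβ.2])
        (harc₁.resolve_left fun h => hnotouter θ r hr hθr (h θ ⟨hαθ, hθβ⟩)) ha hb hr hα hβb hθr hrv
    · obtain rfl := huniq _ _ _ hr hb hθr hβb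
      exact Or.inr ⟨hrv, .refl⟩
    · exact (reachable_end_of_arc hG hF hε hw hwd ⟨hθβ, hθ.2⟩ (by linarith)
        (harc₂.resolve_left fun h => hnotouter θ r hr hθr (h θ ⟨hθβ, hθ.2⟩)) hb ha hr hβb hα' hθr
        hrv).symm
  have hjoin : u (i - 1) ≠ v → u (i + 1) ≠ v →
      ((G.deleteVerts {u i}).deleteVerts {v}).Reachable (u (i + 1)) (u (i - 1)) := by
    intro hav hbv
    by_cases hv : v ∈ Set.range u
    · obtain ⟨j, rfl⟩ := hv
      have hnadj : ¬ G.Adj (u i) (u j) := fun hadj => by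
        rcases hnd i j hadj with rfl | rfl
        · exact hbv rfl
        · exact hav (by rw [add_sub_cancel_right])
      rcases harc₁ with hO | hI₁
      · rcases harc₂ with hO₂ | hI₂
        · refine absurd ?_ (hG.not_eventually_outerRegion hu hε.pos hβb)
          filter_upwards [nhdsWithin_le_nhds (Ioo_mem_nhds hαβ hβ.2), self_mem_nhdsWithin]
            with θ hθ hne
          rcases lt_or_gt_of_ne hne with hlt | hlt
          · exact hO θ ⟨hθ.1, hlt⟩
          · exact hO₂ θ ⟨hlt, hθ.2⟩
        · refine reachable_of_arc hG hF hε hw hwd (I := Set.Icc β (α + 2 * Real.pi))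
            isPreconnected_Icc (fun θ hθ => ?_) (fun _ _ h => absurd h hnadj)
            (Set.left_mem_Icc.2 hβ.2.le) (Set.right_mem_Icc.2 hβ.2.le) hb ha hβb hα'
          rcases hθ.1.eq_or_lt with rfl | h1
          · exact hnotouter _ _ hb hβb
          rcases hθ.2.eq_or_lt with rfl | h2
          · exact hnotouter _ _ ha hα'
          exact hI₂ θ ⟨h1, h2⟩
      · refine reachable_of_arc hG hF hε hw hwd (I := Set.Icc α β)
            isPreconnected_Icc (fun θ hθ => ?_) (fun _ _ h => absurd h hnadj)
            (Set.right_mem_Icc.2 hαβ.le) (Set.left_mem_Icc.2 hαβ.le) hb ha hβb hα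
        rcases hθ.1.eq_or_lt with rfl | h1
        · exact hnotouter _ _ ha hα
        rcases hθ.2.eq_or_lt with rfl | h2
        · exact hnotouter _ _ hb hβb
        exact hI₁ θ ⟨h1, h2⟩
    · exact hu.reachable_of_notMem_range i hv
  rcases hend r hr hrv with ⟨h1, hr'⟩ | ⟨h1, hr'⟩ <;>
    rcases hend s hs hsv with ⟨h2, hs'⟩ | ⟨h2, hs'⟩
  · exact hr'.trans (reachable_symm hs')
  · exact (hr'.trans (reachable_symm (hjoin h1 h2))).trans (reachable_symm hs')
  · exact (hr'.trans (hjoin h2 h1)).trans (reachable_symm hs')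
  · exact hr'.trans (reachable_symm hs')

/-- In a graph that is connected after deletion of `v`, every vertex is joined to a neighbour of
`w` by a walk avoiding `v` and `w`. -/
theorem exists_reachable_neighbor {v w p : ℝ × ℝ} (hv : (G.deleteVerts {v}).Connected)
    (hw : w ∈ G.verts) (hwv : w ≠ v) (hp : p ∈ G.verts) (hpv : p ≠ v) (hpw : p ≠ w) :
    ∃ r, G.Adj w r ∧ r ≠ v ∧ ((G.deleteVerts {w}).deleteVerts {v}).Reachable p r := by
  have hreach := hv.2 p (by simp [deleteVerts, hp, hpv]) w (by simp [deleteVerts, hw, hwv])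
  induction hreach using Relation.ReflTransGen.head_induction_on with
  | refl => exact absurd rfl hpw
  | head hxy hyw ih =>
    rename_i x y
    obtain ⟨hadj, hxv, hyv⟩ := hxy
    rw [Finset.mem_singleton] at hxv hyv
    by_cases hy : y = w
    · subst hy
      exact ⟨x, G.symm _ _ hadj, hxv, .refl⟩
    · obtain ⟨r, hr, hrv, hyr⟩ := ih (G.mem_of_adj _ _ hadj).2 hyv hy
      exact ⟨r, hr, hrv, .head (adj_deleteVerts_pair hadj hpw hy hxv hyv) hyr⟩

theorem IsBoundaryCycle.biconnected_deleteVerts {h : ℕ} {u : ZMod h → ℝ × ℝ}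
    (hu : G.IsBoundaryCycle u) (hG : G.IsNearTriangulation) (hint : ∃ v, G.IsInteriorVtx u v)
    (hnd : G.HasNoDiagonals u) (i : ZMod h) : (G.deleteVerts {u i}).Biconnected := by
  obtain ⟨hE, ⟨-, -, hconn⟩, hF⟩ := hG
  have hw := hu.2.2.1 i
  have ha := hu.adj_sub_one i
  have hb := hu.2.2.2.1 i
  have hab := hu.sub_one_ne_add_one i
  refine ⟨?_, hconn _ hw, fun v hv => ⟨?_, fun p hp q hq => ?_⟩⟩
  · obtain ⟨x, hx, hxu⟩ := hint
    have hx' : ∀ j, u j ≠ x := fun j hj => hxu ⟨j, hj⟩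
    rw [← Finset.card_eq_three.2 ⟨_, _, x, hab, hx' _, hx' _, rfl⟩]
    refine Finset.card_le_card fun y hy => ?_
    simp only [Finset.mem_insert, Finset.mem_singleton] at hy
    simp only [deleteVerts, Finset.mem_sdiff, Finset.mem_singleton]
    rcases hy with rfl | rfl | rfl
    · exact ⟨hu.2.2.1 _, (ne_of_adj ha).symm⟩
    · exact ⟨hu.2.2.1 _, (ne_of_adj hb).symm⟩
    · exact ⟨hx, (hx' i).symm⟩
  · by_cases hv' : u (i - 1) = v
    · exact ⟨u (i + 1), by
        simp [deleteVerts, hu.2.2.1, (ne_of_adj hb).symm, ← hv', hab.symm]⟩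
    · exact ⟨u (i - 1), by simp [deleteVerts, hu.2.2.1, (ne_of_adj ha).symm, hv']⟩
  · simp only [deleteVerts, Finset.mem_sdiff, Finset.mem_singleton] at hv hp hq
    obtain ⟨r, hr, hrv, hpr⟩ :=
      exists_reachable_neighbor (hconn v hv.1) hw (Ne.symm hv.2) hp.1.1 hp.2 hp.1.2
    obtain ⟨s, hs, hsv, hqs⟩ :=
      exists_reachable_neighbor (hconn v hv.1) hw (Ne.symm hv.2) hq.1.1 hq.2 hq.1.2
    exact (hpr.trans (hu.reachable_neighbors hE hF hnd hv.2 hr hs hrv hsv)).trans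
      (reachable_symm hqs)

end PlaneGraph

/-- Let `T` be a near-triangulation with boundary cycle
`C = (u_1, …, u_h, u_1)` that contains at least one interior vertex and has no diagonals.
Then for every boundary vertex `u_i`, the graph `T − {u_i}` is a near-triangulation. -/
theorem deleteBoundaryVert_isNearTriangulation (T : PlaneGraph) (h : ℕ)
    (u : ZMod h → ℝ × ℝ)
    (hT : T.IsNearTriangulation) (hu : T.IsBoundaryCycle u)
    (hint : ∃ v, T.IsInteriorVtx u v) (hnd : T.HasNoDiagonals u) (i : ZMod h) :
    (T.deleteVerts {u i}).IsNearTriangulation := by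
  have hcl : u i ∈ closure T.outerRegion :=
    frontier_subset_closure (hu.2.2.2.2.1 i (left_mem_segment ℝ _ _))
  exact ⟨hT.1.deleteVerts _, hu.biconnected_deleteVerts hT hint hnd i,
    hT.1.innerFacesTriangles_deleteVerts hT.2.2 (hu.2.2.1 i) hcl⟩
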